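/- The homomorphism χ (with χ(z) = [z,0,1] - [z,0,0]) maps the group μ* of roots of unity in ℂ* into êB(ℂ), and the resulting sequence 0 → μ* → êB(ℂ) → B(ℂ) → 0 is exact, where êB(ℂ) → B(ℂ) is induced by [z,p,q] ↦ [z]. -/

import Mathlib

open Complex
open scoped Classical

noncomputable section

namespace ExtendedBloch

/-- `π` as a complex number. -/
def Cpi : ℂ := (Real.pi : ℂ)

/-- Membership in `ℂ ∖ {0,1}`. -/
def Reg (z : ℂ) : Prop := z ≠ 0 ∧ z ≠ 1

/-- The open upper half plane. -/
def UHP : Set ℂ := {z : ℂ | 0 < z.im}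

/-- The 5-tuple occurring in the five term relation. -/
def ftTuple (x y : ℂ) : Fin 5 → ℂ :=
  ![x, y, y / x, (1 - x⁻¹) / (1 - y⁻¹), (1 - x) / (1 - y)]

/-- The set `FT` of five term tuples. -/
def FT : Set (Fin 5 → ℂ) :=
  {v | ∃ x y : ℂ, Reg x ∧ Reg y ∧ x ≠ y ∧ v = ftTuple x y}

/-- The subset `FT⁺` of tuples with all coordinates in the upper half plane. -/
def FTplus : Set (Fin 5 → ℂ) := {v | v ∈ FT ∧ ∀ i, v i ∈ UHP}

/-- The point `(z; p, q)` of the cover `𝓒` of `ℂ ∖ {0,1}`, realized concretely as the pair of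
branch values `(log z + pπi, -log(1-z) + qπi)` (Riemann surface model of `𝓒`). -/
def pt (z : ℂ) (p q : ℤ) : ℂ × ℂ :=
  (Complex.log z + p * (Cpi * I), -Complex.log (1 - z) + q * (Cpi * I))

/-- The cover `𝓒`, realized as the Riemann surface of all branches of
`(log z + pπi, -log(1-z) + qπi)` on `ℂ ∖ {0,1}`. -/
def Cover : Set (ℂ × ℂ) := {w | ∃ z : ℂ, Reg z ∧ ∃ p q : ℤ, w = pt z p q}

lemma pt_mem_Cover {z : ℂ} (h : Reg z) (p q : ℤ) : pt z p q ∈ Cover :=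
  ⟨z, h, p, q, rfl⟩

/-- `w ∈ 𝓒` lies over `z ∈ ℂ ∖ {0,1}`. -/
def LiesOver (w : ℂ × ℂ) (z : ℂ) : Prop := Reg z ∧ ∃ p q : ℤ, w = pt z p q

/-- The covering action of `ℤ × ℤ` on `𝓒`. -/
def covAct (v : ℤ × ℤ) (w : ℂ × ℂ) : ℂ × ℂ :=
  (w.1 + v.1 * (Cpi * I), w.2 + v.2 * (Cpi * I))

/-- The subset `V ⊂ (ℤ × ℤ)⁵`. -/
def Vset : Set (Fin 5 → ℤ × ℤ) :=
  {v | ∃ p₀ p₁ q₀ q₁ q₂ : ℤ,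
    v = ![(p₀, q₀), (p₁, q₁), (p₁ - p₀, q₂), (p₁ - p₀ + q₁ - q₀, q₂ - q₁),
          (q₁ - q₀, q₂ - q₁ - p₀)]}

/-- The preimage of `FT` in `𝓒⁵`. -/
def FTpre : Set (Fin 5 → ℂ × ℂ) := {w | ∃ v ∈ FT, ∀ i, LiesOver (w i) (v i)}

/-- A base point `((x₀;0,0),…,(x₄;0,0))` with `(x₀,…,x₄) ∈ FT⁺`. -/
def basePt : Fin 5 → ℂ × ℂ := fun i => pt (ftTuple ((1 + I) / 4) I i) 0 0

/-- `𝓕𝓣̂₀`: the connected component of the preimage of `FT` in `𝓒⁵` containing the points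
`((x₀;0,0),…,(x₄;0,0))` with `(x₀,…,x₄) ∈ FT⁺`. -/
def FThat₀ : Set (Fin 5 → ℂ × ℂ) := connectedComponentIn FTpre basePt

/-- `𝓕𝓣̂ = 𝓕𝓣̂₀ + V`. -/
def FThat : Set (Fin 5 → ℂ × ℂ) :=
  {u | ∃ w ∈ FThat₀, ∃ v ∈ Vset, u = fun i => covAct (v i) (w i)}

abbrev CoverT : Type := ↥Cover

/-- The generator `(z; p, q)` of the free abelian group on `𝓒`. -/
def genOf (z : ℂ) (h : Reg z) (p q : ℤ) : FreeAbelianGroup CoverT :=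
  FreeAbelianGroup.of ⟨pt z p q, pt_mem_Cover h p q⟩

/-- The lifted five term relators. -/
def FiveTermRels : Set (FreeAbelianGroup CoverT) :=
  {a | ∃ w : Fin 5 → ℂ × ℂ, w ∈ FThat ∧ ∃ hc : ∀ i, w i ∈ Cover,
    a = ∑ i : Fin 5, (-1 : ℤ) ^ (i : ℕ) • FreeAbelianGroup.of (⟨w i, hc i⟩ : CoverT)}

/-- The transfer relators. -/
def TransferRels : Set (FreeAbelianGroup CoverT) :=
  {a | ∃ z : ℂ, ∃ h : Reg z, ∃ p q p' q' : ℤ,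
    a = genOf z h p q + genOf z h p' q' - genOf z h p q' - genOf z h p' q}

def relSub : AddSubgroup (FreeAbelianGroup CoverT) :=
  AddSubgroup.closure (FiveTermRels ∪ TransferRels)

def relSub' : AddSubgroup (FreeAbelianGroup CoverT) :=
  AddSubgroup.closure FiveTermRels

/-- The extended pre-Bloch group `êP(ℂ)`. -/
abbrev EPreBloch : Type := FreeAbelianGroup CoverT ⧸ relSub

/-- The variant `êP'(ℂ)` without the transfer relations. -/
abbrev EPreBloch' : Type := FreeAbelianGroup CoverT ⧸ relSub'

/-- The class `[z, p, q] ∈ êP(ℂ)` (junk value `0` if `z ∈ {0,1}`). -/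
def cls (z : ℂ) (p q : ℤ) : EPreBloch :=
  if h : Reg z then QuotientAddGroup.mk (genOf z h p q) else 0

/-- The class `[z, p, q] ∈ êP'(ℂ)` (junk value `0` if `z ∈ {0,1}`). -/
def cls' (z : ℂ) (p q : ℤ) : EPreBloch' :=
  if h : Reg z then QuotientAddGroup.mk (genOf z h p q) else 0

/-- `ℂ ∧_ℤ ℂ`, the second exterior power of `ℂ` as a `ℤ`-module. -/
abbrev L2C : Type := ↥(⋀[ℤ]^2 ℂ)

/-- The wedge `a ∧ b ∈ ℂ ∧_ℤ ℂ`. -/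
def wedge (a b : ℂ) : L2C :=
  ⟨ExteriorAlgebra.ιMulti ℤ 2 ![a, b],
   ExteriorAlgebra.ιMulti_range ℤ 2 (Set.mem_range_self _)⟩

def nuFree : FreeAbelianGroup CoverT →+ L2C :=
  FreeAbelianGroup.lift fun w : CoverT => wedge w.1.1 w.1.2

/-- The homomorphism `ν : êP(ℂ) → ℂ ∧_ℤ ℂ`. -/
def nuHom : EPreBloch →+ L2C :=
  if h : ∀ a ∈ relSub, nuFree a = 0 then QuotientAddGroup.lift relSub nuFree h else 0

/-- The homomorphism `ν : êP'(ℂ) → ℂ ∧_ℤ ℂ`. -/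
def nuHom' : EPreBloch' →+ L2C :=
  if h : ∀ a ∈ relSub', nuFree a = 0 then QuotientAddGroup.lift relSub' nuFree h else 0

/-- The extended Bloch group `êB(ℂ) = ker ν`. -/
def EBloch : AddSubgroup EPreBloch := nuHom.ker

/-- `êB'(ℂ) = ker ν` on `êP'(ℂ)`. -/
def EBloch' : AddSubgroup EPreBloch' := nuHom'.ker

/-- The component `X₀₀` of `𝓒` (both fiber coordinates even). -/
def X00 : Set (ℂ × ℂ) := {w | ∃ z : ℂ, Reg z ∧ ∃ p q : ℤ, w = pt z (2 * p) (2 * q)}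

abbrev X00T : Type := ↥X00

lemma pt_mem_X00 {z : ℂ} (h : Reg z) (p q : ℤ) : pt z (2 * p) (2 * q) ∈ X00 :=
  ⟨z, h, p, q, rfl⟩

/-- The generator `(z; 2p, 2q)` of the free abelian group on `X₀₀`. -/
def genOf₀ (z : ℂ) (h : Reg z) (p q : ℤ) : FreeAbelianGroup X00T :=
  FreeAbelianGroup.of ⟨pt z (2 * p) (2 * q), pt_mem_X00 h p q⟩

/-- The five term relators coming from `𝓕𝓣̂ ∩ (X₀₀)⁵`. -/
def FiveTermRels₀ : Set (FreeAbelianGroup X00T) :=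
  {a | ∃ w : Fin 5 → ℂ × ℂ, w ∈ FThat ∧ ∃ hc : ∀ i, w i ∈ X00,
    a = ∑ i : Fin 5, (-1 : ℤ) ^ (i : ℕ) • FreeAbelianGroup.of (⟨w i, hc i⟩ : X00T)}

def relSub₀ : AddSubgroup (FreeAbelianGroup X00T) := AddSubgroup.closure FiveTermRels₀

/-- The true extended pre-Bloch group `êêP(ℂ)`. -/
abbrev EEPreBloch : Type := FreeAbelianGroup X00T ⧸ relSub₀

/-- The class `[z, 2p, 2q] ∈ êêP(ℂ)` (junk value `0` if `z ∈ {0,1}`). -/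
def cls₀ (z : ℂ) (p q : ℤ) : EEPreBloch :=
  if h : Reg z then QuotientAddGroup.mk (genOf₀ z h p q) else 0

def nuFree₀ : FreeAbelianGroup X00T →+ L2C :=
  FreeAbelianGroup.lift fun w : X00T => wedge w.1.1 w.1.2

/-- The homomorphism `ν̂ : êêP(ℂ) → ℂ ∧_ℤ ℂ`. -/
def nuHom₀ : EEPreBloch →+ L2C :=
  if h : ∀ a ∈ relSub₀, nuFree₀ a = 0 then QuotientAddGroup.lift relSub₀ nuFree₀ h else 0

/-- The true extended Bloch group `êêB(ℂ) = ker ν̂`. -/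
def EEBloch : AddSubgroup EEPreBloch := nuHom₀.ker

/-- The Rogers dilogarithm `𝓡(z) = ½ log z log(1-z) - ∫₀ᶻ log(1-t)/t dt` (straight segment,
parametrized by `t = s z`). -/
def rogers (z : ℂ) : ℂ :=
  (1 / 2) * Complex.log z * Complex.log (1 - z) -
    ∫ s in (0:ℝ)..(1:ℝ), Complex.log (1 - (s : ℂ) * z) / (s : ℂ)

/-- `R(z; p, q) = 𝓡(z) + (πi/2)(p log(1-z) + q log z) - π²/6`. -/
def Rfun (z : ℂ) (p q : ℤ) : ℂ :=
  rogers z + (Cpi * I / 2) * (p * Complex.log (1 - z) + q * Complex.log z) - Cpi ^ 2 / 6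

/-- `R̂(z; 2p, 2q) = 𝓡(z) + πi(p log(1-z) + q log z) - π²/6`. -/
def Rhat (z : ℂ) (p q : ℤ) : ℂ :=
  rogers z + Cpi * I * (p * Complex.log (1 - z) + q * Complex.log z) - Cpi ^ 2 / 6

/-- `ℂ / π²ℤ`. -/
abbrev ModPiSq : Type := ℂ ⧸ AddSubgroup.zmultiples (Cpi ^ 2)

/-- `ℂ / 2π²ℤ`. -/
abbrev Mod2PiSq : Type := ℂ ⧸ AddSubgroup.zmultiples (2 * Cpi ^ 2)

abbrev RegT : Type := {z : ℂ // Reg z}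

def pbGen (z : ℂ) (h : Reg z) : FreeAbelianGroup RegT := FreeAbelianGroup.of ⟨z, h⟩

/-- The five term relators for the classical pre-Bloch group. -/
def pbRels : Set (FreeAbelianGroup RegT) :=
  {a | ∃ x y : ℂ, ∃ hx : Reg x, ∃ hy : Reg y, x ≠ y ∧
    ∃ h2 : Reg (y / x), ∃ h3 : Reg ((1 - x⁻¹) / (1 - y⁻¹)), ∃ h4 : Reg ((1 - x) / (1 - y)),
    a = pbGen x hx - pbGen y hy + pbGen (y / x) h2 -
        pbGen ((1 - x⁻¹) / (1 - y⁻¹)) h3 + pbGen ((1 - x) / (1 - y)) h4}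

def pbSub : AddSubgroup (FreeAbelianGroup RegT) := AddSubgroup.closure pbRels

/-- The classical pre-Bloch group `P(ℂ)`. -/
abbrev PreBloch : Type := FreeAbelianGroup RegT ⧸ pbSub

/-- The class `[z] ∈ P(ℂ)` (junk value `0` if `z ∈ {0,1}`). -/
def pbCls (z : ℂ) : PreBloch :=
  if h : Reg z then QuotientAddGroup.mk (pbGen z h) else 0

/-- `ℂ* ∧_ℤ ℂ*`, the second exterior power of the multiplicative group `ℂ*` as `ℤ`-module. -/
abbrev L2CU : Type := ↥(⋀[ℤ]^2 (Additive ℂˣ))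

/-- The wedge `a ∧ b ∈ ℂ* ∧_ℤ ℂ*`. -/
def wedgeU (a b : ℂˣ) : L2CU :=
  ⟨ExteriorAlgebra.ιMulti ℤ 2 ![Additive.ofMul a, Additive.ofMul b],
   ExteriorAlgebra.ιMulti_range ℤ 2 (Set.mem_range_self _)⟩

def nuPBFree : FreeAbelianGroup RegT →+ L2CU :=
  FreeAbelianGroup.lift fun z : RegT =>
    2 • wedgeU (Units.mk0 z.1 z.2.1) (Units.mk0 (1 - z.1) (sub_ne_zero_of_ne (Ne.symm z.2.2)))

/-- The homomorphism `P(ℂ) → ℂ* ∧_ℤ ℂ*`, `[z] ↦ 2 (z ∧ (1-z))`. -/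
def nuPB : PreBloch →+ L2CU :=
  if h : ∀ a ∈ pbSub, nuPBFree a = 0 then QuotientAddGroup.lift pbSub nuPBFree h else 0

/-- The classical Bloch group `B(ℂ)`. -/
def Bloch : AddSubgroup PreBloch := nuPB.ker

/-- The roots of unity in `ℂ*`. -/
def muStar : Set ℂˣ := {ζ | ∃ n : ℕ, 0 < n ∧ ζ ^ n = 1}

abbrev SL2C := Matrix.SpecialLinearGroup (Fin 2) ℂ

/-- `PSL(2,ℂ) = SL(2,ℂ)/{±1}` as a discrete group. -/
abbrev PSL2C := SL2C ⧸ Subgroup.center SL2C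

/-- The boundary map `C₃ → C₂` of the inhomogeneous bar complex computing `H₃(PSL(2,ℂ);ℤ)`. -/
def d3 : FreeAbelianGroup (Fin 3 → PSL2C) →+ FreeAbelianGroup (Fin 2 → PSL2C) :=
  FreeAbelianGroup.lift fun g =>
    FreeAbelianGroup.of ![g 1, g 2] - FreeAbelianGroup.of ![g 0 * g 1, g 2] +
      FreeAbelianGroup.of ![g 0, g 1 * g 2] - FreeAbelianGroup.of ![g 0, g 1]

/-- The boundary map `C₄ → C₃` of the inhomogeneous bar complex computing `H₃(PSL(2,ℂ);ℤ)`. -/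
def d4 : FreeAbelianGroup (Fin 4 → PSL2C) →+ FreeAbelianGroup (Fin 3 → PSL2C) :=
  FreeAbelianGroup.lift fun g =>
    FreeAbelianGroup.of ![g 1, g 2, g 3] - FreeAbelianGroup.of ![g 0 * g 1, g 2, g 3] +
      FreeAbelianGroup.of ![g 0, g 1 * g 2, g 3] - FreeAbelianGroup.of ![g 0, g 1, g 2 * g 3] +
      FreeAbelianGroup.of ![g 0, g 1, g 2]

/-- `H₃(PSL(2,ℂ);ℤ)`, defined as homology of the inhomogeneous bar complex. -/
abbrev H3PSL2C : Type := ↥d3.ker ⧸ ((d4.range).addSubgroupOf d3.ker)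

/-- The set of combinatorial flattenings. -/
def Flattenings : Set (ℂ × ℂ × ℂ) :=
  {w | w.1 + w.2.1 + w.2.2 = 0 ∧ ∃ z : ℂ, Reg z ∧ ∃ p q r : ℤ,
    w.1 = Complex.log z + p * (Cpi * I) ∧
    w.2.1 = -Complex.log (1 - z) + q * (Cpi * I) ∧
    w.2.2 = Complex.log (1 - z) - Complex.log z + r * (Cpi * I)}

/-- The map `ℓ : 𝓒 → ℂ³`. -/
def ellMap (w : ℂ × ℂ) : ℂ × ℂ × ℂ := (w.1, w.2, -w.1 - w.2)

/-- The element `κ = [x,1,1] + [x,0,0] - [x,1,0] - [x,0,1] ∈ êP'(ℂ)`. -/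
def kap (x : ℂ) : EPreBloch' := cls' x 1 1 + cls' x 0 0 - cls' x 1 0 - cls' x 0 1

/-- The natural projection `êP'(ℂ) → êP(ℂ)`. -/
def projP : EPreBloch' →+ EPreBloch :=
  QuotientAddGroup.map relSub' relSub (AddMonoidHom.id _)
    (by
      rw [AddSubgroup.comap_id]
      exact AddSubgroup.closure_mono Set.subset_union_left)

open Topology

lemma Cpi_mul_I_ne_zero : Cpi * I ≠ 0 :=
  mul_ne_zero (ofReal_ne_zero.2 Real.pi_ne_zero) I_ne_zero

lemma exp_int_mul_two_Cpi (n : ℤ) : exp (2 * (n * (Cpi * I))) = 1 :=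
  exp_eq_one_iff.2 ⟨n, by rw [Cpi]; ring⟩

lemma exists_int_of_exp_two_mul {u : ℂ} (h : exp (2 * u) = 1) : ∃ n : ℤ, u = n * (Cpi * I) := by
  obtain ⟨n, hn⟩ := exp_eq_one_iff.1 h
  exact ⟨n, by rw [Cpi]; linear_combination hn / 2⟩

lemma Reg.one_sub_ne {z : ℂ} (h : Reg z) : 1 - z ≠ 0 := sub_ne_zero_of_ne h.2.symm

/-- Lying over `z` can be tested by exponentiating both coordinates. -/
lemma liesOver_iff {w : ℂ × ℂ} {z : ℂ} :
    LiesOver w z ↔ Reg z ∧ exp (2 * w.1) = z ^ 2 ∧ exp (2 * w.2) * (1 - z) ^ 2 = 1 := by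
  refine and_congr_right fun hz => ?_
  have e1 : exp (2 * log z) = z ^ 2 := by rw [two_mul, exp_add, exp_log hz.1, sq]
  have e2 : exp (2 * log (1 - z)) = (1 - z) ^ 2 := by
    rw [two_mul, exp_add, exp_log hz.one_sub_ne, sq]
  constructor
  · rintro ⟨p, q, rfl⟩
    refine ⟨?_, ?_⟩
    · rw [pt, mul_add, exp_add, e1, exp_int_mul_two_Cpi, mul_one]
    · rw [pt, ← e2, ← exp_add, ← exp_int_mul_two_Cpi q]
      congr 1
      ring
  · rintro ⟨h1, h2⟩
    obtain ⟨p, hp⟩ := exists_int_of_exp_two_mul (u := w.1 - log z) (by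
      rw [mul_sub, exp_sub, h1, e1, div_self (pow_ne_zero 2 hz.1)])
    obtain ⟨q, hq⟩ := exists_int_of_exp_two_mul (u := w.2 + log (1 - z)) (by
      rw [mul_add, exp_add, e2, h2])
    exact ⟨p, q, Prod.ext (by rw [pt]; linear_combination hp)
      (by rw [pt]; linear_combination hq)⟩

lemma liesOver_pt {z : ℂ} (hz : Reg z) (p q : ℤ) : LiesOver (pt z p q) z := ⟨hz, p, q, rfl⟩

lemma LiesOver.mem_Cover {w : ℂ × ℂ} {z : ℂ} (h : LiesOver w z) : w ∈ Cover :=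
  ⟨z, h.1, h.2⟩

lemma LiesOver.unique {w : ℂ × ℂ} {z z' : ℂ} (h : LiesOver w z) (h' : LiesOver w z') : z = z' := by
  obtain ⟨-, h1, h2⟩ := liesOver_iff.1 h
  obtain ⟨-, h1', h2'⟩ := liesOver_iff.1 h'
  have e1 : z ^ 2 = z' ^ 2 := h1.symm.trans h1'
  have e2 : (1 - z) ^ 2 = (1 - z') ^ 2 := mul_left_cancel₀ (exp_ne_zero _) (h2.trans h2'.symm)
  linear_combination (e1 - e2) / 2

lemma covAct_pt (z : ℂ) (p q : ℤ) (v : ℤ × ℤ) : covAct v (pt z p q) = pt z (p + v.1) (q + v.2) := by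
  simp only [covAct, pt, Int.cast_add]
  exact Prod.ext (by ring) (by ring)

lemma LiesOver.covAct {w : ℂ × ℂ} {z : ℂ} (h : LiesOver w z) (v : ℤ × ℤ) :
    LiesOver (covAct v w) z := by
  obtain ⟨hz, p, q, rfl⟩ := h
  exact covAct_pt z p q v ▸ liesOver_pt hz _ _

/-! ### The second exterior power -/

/-- An alternating biadditive map induces a homomorphism on the second exterior power. -/
lemma exists_hom_exteriorPower {M N : Type*} [AddCommGroup M] [AddCommGroup N] (f : M →+ M →+ N)
    (hf : ∀ a, f a a = 0) :
    ∃ F : ↥(⋀[ℤ]^2 M) →+ N, ∀ a b : M, F (exteriorPower.ιMulti ℤ 2 ![a, b]) = f a b := by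
  let A : M [⋀^Fin 2]→ₗ[ℤ] N :=
    { toFun := fun v => f (v 0) (v 1)
      map_update_add' := by
        intro _ m i x y
        fin_cases i <;> simp [Function.update]
      map_update_smul' := by
        intro _ m i c x
        fin_cases i <;> simp [Function.update]
      map_eq_zero_of_eq' := by
        intro v i j h hij
        fin_cases i <;> fin_cases j <;> simp_all }
  refine ⟨(exteriorPower.alternatingMapLinearEquiv A).toAddMonoidHom, fun a b => ?_⟩
  exact exteriorPower.alternatingMapLinearEquiv_apply_ιMulti A ![a, b]

lemma ιMulti_add_right {M : Type*} [AddCommGroup M] (a b b' : M) :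
    exteriorPower.ιMulti ℤ 2 ![a, b + b'] =
      exteriorPower.ιMulti ℤ 2 ![a, b] + exteriorPower.ιMulti ℤ 2 ![a, b'] := by
  have e : ∀ x : M, Function.update ![a, b] 1 x = ![a, x] := fun x => by
    ext i; fin_cases i <;> rfl
  simpa only [e] using (exteriorPower.ιMulti ℤ 2 (M := M)).map_update_add ![a, b] 1 b b'

lemma ιMulti_add_left {M : Type*} [AddCommGroup M] (a a' b : M) :
    exteriorPower.ιMulti ℤ 2 ![a + a', b] =
      exteriorPower.ιMulti ℤ 2 ![a, b] + exteriorPower.ιMulti ℤ 2 ![a', b] := by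
  have e : ∀ x : M, Function.update ![a, b] 0 x = ![x, b] := fun x => by
    ext i; fin_cases i <;> rfl
  simpa only [e] using (exteriorPower.ιMulti ℤ 2 (M := M)).map_update_add ![a, b] 0 a a'

/-- The wedge product as a biadditive map. -/
def wedgeHom (M : Type*) [AddCommGroup M] : M →+ M →+ ↥(⋀[ℤ]^2 M) :=
  AddMonoidHom.mk' (fun a => AddMonoidHom.mk' (fun b => exteriorPower.ιMulti ℤ 2 ![a, b])
    (ιMulti_add_right a)) fun a a' => AddMonoidHom.ext fun b => ιMulti_add_left a a' b

lemma wedgeHom_self {M : Type*} [AddCommGroup M] (a : M) : wedgeHom M a a = 0 :=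
  (exteriorPower.ιMulti ℤ 2 (M := M)).map_eq_zero_of_eq ![a, a] (i := 0) (j := 1) rfl (by decide)

lemma wedgeHom_swap {M : Type*} [AddCommGroup M] (a b : M) :
    wedgeHom M a b = -wedgeHom M b a := by
  have h := wedgeHom_self (a + b)
  simp only [map_add, AddMonoidHom.add_apply, wedgeHom_self, zero_add, add_zero] at h
  exact eq_neg_of_add_eq_zero_right h

lemma wedge_eq_wedgeHom (a b : ℂ) : wedge a b = wedgeHom ℂ a b := rfl

lemma wedgeU_eq_wedgeHom (a b : ℂˣ) :
    wedgeU a b = wedgeHom (Additive ℂˣ) (Additive.ofMul a) (Additive.ofMul b) := rfl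

lemma exteriorPower_hom_ext {M N : Type*} [AddCommGroup M] [AddCommGroup N]
    {f g : ↥(⋀[ℤ]^2 M) →+ N} (h : ∀ a b, f (wedgeHom M a b) = g (wedgeHom M a b)) : f = g := by
  have : f.toIntLinearMap = g.toIntLinearMap := by
    refine exteriorPower.linearMap_ext (AlternatingMap.ext fun v => ?_)
    have e : v = ![v 0, v 1] := by ext i; fin_cases i <;> rfl
    rw [e]
    exact h _ _
  ext x
  exact DFunLike.congr_fun this x

/-- If `a ∧ b = 0` with `b ≠ 0`, then `a` is a rational multiple of `b`. -/
lemma exists_rat_of_wedge_eq_zero {a b : ℂ} (hb : b ≠ 0) (h : wedge a b = 0) :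
    ∃ r : ℚ, a = r * b := by
  by_contra hr
  push Not at hr
  have hli : LinearIndependent ℚ ![a, b] := by
    rw [LinearIndependent.pair_iff]
    intro s t hst
    rw [Rat.smul_def, Rat.smul_def] at hst
    have hs : s = 0 := by
      by_contra hs
      have hs' : (s : ℂ) ≠ 0 := Rat.cast_ne_zero.2 hs
      refine hr (-t / s) ?_
      push_cast
      field_simp
      linear_combination hst
    subst hs
    simpa [hb] using hst
  let B := Module.Basis.sumExtend hli
  let g : ℂ →+ ℚ := (B.coord (Sum.inl 0)).toAddMonoidHom
  let k : ℂ →+ ℚ := (B.coord (Sum.inl 1)).toAddMonoidHom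
  have hB : ∀ i : Fin 2, B (Sum.inl i) = ![a, b] i := fun i => by
    simp only [B, Module.Basis.sumExtend, Module.Basis.reindex_apply, Module.Basis.extend_apply_self]
    rfl
  have ha' : B (Sum.inl 0) = a := hB 0
  have hb' : B (Sum.inl 1) = b := hB 1
  let D : ℂ →+ ℂ →+ ℚ := AddMonoidHom.mk'
    (fun x => (AddMonoidHom.mulLeft (g x)).comp k - (AddMonoidHom.mulLeft (k x)).comp g)
    fun x y => AddMonoidHom.ext fun z => by simp; ring
  obtain ⟨F, hF⟩ := exists_hom_exteriorPower D (fun x => by simp [D, mul_comm])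
  have h1 := hF a b
  rw [show exteriorPower.ιMulti ℤ 2 ![a, b] = wedge a b from rfl, h, map_zero] at h1
  have ga : g a = 1 := by rw [← ha']; simp [g]
  have gb : g b = 0 := by rw [← hb']; simp [g]
  have ka : k a = 0 := by rw [← ha']; simp [k]
  have kb : k b = 1 := by rw [← hb']; simp [k]
  simp [D, ga, gb, ka, kb] at h1

/-! ### The set of lifted five term tuples -/

/-- The linear relations between the branches of the logarithm that cut out `𝓕𝓣̂` inside the
preimage of `FT`. -/
structure FiveTermLinear (w : Fin 5 → ℂ × ℂ) : Prop where
  fst_two : (w 2).1 = (w 1).1 - (w 0).1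
  fst_three : (w 3).1 = (w 2).1 + (w 4).1
  fst_four : (w 4).1 = (w 1).2 - (w 0).2
  snd_three : (w 3).2 = (w 2).2 - (w 1).2
  snd_four : (w 4).2 = (w 3).2 - (w 0).1

/-- The parameters `(x, y)` of a five term tuple. -/
structure Adm (x y : ℂ) : Prop where
  left : Reg x
  right : Reg y
  ne : x ≠ y

namespace Adm

lemma sub_ne {x y : ℂ} (h : Adm x y) : x - y ≠ 0 := sub_ne_zero_of_ne h.ne

lemma ftTuple_three {x y : ℂ} (h : Adm x y) : ftTuple x y 3 = y * (1 - x) / (x * (1 - y)) := by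
  have h1 := h.left.1
  have h2 := h.right.1
  have h3 := h.right.one_sub_ne
  have h4 : y - 1 ≠ 0 := sub_ne_zero_of_ne h.right.2
  have e : 1 - y⁻¹ = (y - 1) / y := by field_simp
  simp only [ftTuple, Matrix.cons_val]
  rw [e, div_div_eq_mul_div, div_eq_div_iff h4 (mul_ne_zero h1 h3)]
  field_simp
  ring

lemma one_sub_two {x y : ℂ} (h : Adm x y) : 1 - ftTuple x y 2 = (x - y) / x := by
  have h1 := h.left.1
  simp only [ftTuple, Matrix.cons_val]
  field_simp

lemma one_sub_three {x y : ℂ} (h : Adm x y) : 1 - ftTuple x y 3 = (x - y) / (x * (1 - y)) := by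
  have h1 := h.left.1
  have h3 := h.right.one_sub_ne
  rw [h.ftTuple_three]
  field_simp
  ring

lemma one_sub_four {x y : ℂ} (h : Adm x y) : 1 - ftTuple x y 4 = (x - y) / (1 - y) := by
  have h3 := h.right.one_sub_ne
  simp only [ftTuple, Matrix.cons_val]
  field_simp
  ring

lemma reg_ftTuple {x y : ℂ} (h : Adm x y) (i : Fin 5) : Reg (ftTuple x y i) := by
  have h1 := h.left.1
  have h2 := h.right.1
  have h3 := h.right.one_sub_ne
  have h4 := h.left.one_sub_ne
  have h5 := h.sub_ne
  have key : ∀ z : ℂ, z ≠ 0 → 1 - z ≠ 0 → Reg z := fun z a b => ⟨a, fun e => b (by rw [e, sub_self])⟩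
  fin_cases i
  · exact h.left
  · exact h.right
  · exact key _ (div_ne_zero h2 h1) (by
      have := h.one_sub_two
      simp only [Fin.reduceFinMk] at this ⊢
      rw [this]
      exact div_ne_zero h5 h1)
  · exact key _ (by
      have := h.ftTuple_three
      simp only [Fin.reduceFinMk] at this ⊢
      rw [this]
      exact div_ne_zero (mul_ne_zero h2 h4) (mul_ne_zero h1 h3)) (by
      have := h.one_sub_three
      simp only [Fin.reduceFinMk] at this ⊢
      rw [this]
      exact div_ne_zero h5 (mul_ne_zero h1 h3))
  · exact key _ (div_ne_zero h4 h3) (by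
      have := h.one_sub_four
      simp only [Fin.reduceFinMk] at this ⊢
      rw [this]
      exact div_ne_zero h5 h3)

lemma ftTuple_mem {x y : ℂ} (h : Adm x y) : ftTuple x y ∈ FT := ⟨x, y, h.left, h.right, h.ne, rfl⟩

/-- For tuples satisfying the linear relations, lying over a five term tuple is a condition on
five of the ten coordinates. -/
lemma liesOver_of_linear {x y : ℂ} (h : Adm x y) {w : Fin 5 → ℂ × ℂ} (hw : FiveTermLinear w)
    (a₀ : exp (2 * (w 0).1) = x ^ 2) (a₁ : exp (2 * (w 1).1) = y ^ 2)
    (b₀ : exp (2 * (w 0).2) * (1 - x) ^ 2 = 1) (b₁ : exp (2 * (w 1).2) * (1 - y) ^ 2 = 1)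
    (b₂ : exp (2 * (w 2).2) * (x - y) ^ 2 = x ^ 2) (i : Fin 5) :
    LiesOver (w i) (ftTuple x y i) := by
  have h1 := h.left.1
  have h2 := h.right.1
  have h3 := h.right.one_sub_ne
  have h4 := h.left.one_sub_ne
  have h5 := h.sub_ne
  have a₂ : exp (2 * (w 2).1) = y ^ 2 / x ^ 2 := by
    rw [hw.fst_two, mul_sub, exp_sub, a₀, a₁]
  have b₀' := eq_div_of_mul_eq (pow_ne_zero 2 h4) b₀
  have b₁' := eq_div_of_mul_eq (pow_ne_zero 2 h3) b₁
  have b₂' := eq_div_of_mul_eq (pow_ne_zero 2 h5) b₂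
  have a₄ : exp (2 * (w 4).1) = (1 - x) ^ 2 / (1 - y) ^ 2 := by
    rw [hw.fst_four, mul_sub, exp_sub, b₀', b₁']
    field_simp
  have a₃ : exp (2 * (w 3).1) = y ^ 2 / x ^ 2 * ((1 - x) ^ 2 / (1 - y) ^ 2) := by
    rw [hw.fst_three, mul_add, exp_add, a₂, a₄]
  have b₃ : exp (2 * (w 3).2) = x ^ 2 / (x - y) ^ 2 * (1 - y) ^ 2 := by
    rw [hw.snd_three, mul_sub, exp_sub, b₂', b₁']
    field_simp
  have b₄ : exp (2 * (w 4).2) = (1 - y) ^ 2 / (x - y) ^ 2 := by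
    rw [hw.snd_four, mul_sub, exp_sub, b₃, a₀]
    field_simp
  refine liesOver_iff.2 ⟨h.reg_ftTuple i, ?_⟩
  fin_cases i
  · exact ⟨a₀, b₀⟩
  · exact ⟨a₁, b₁⟩
  · refine ⟨a₂.trans ?_, ?_⟩
    · simp only [ftTuple, Matrix.cons_val, Fin.reduceFinMk]
      field_simp
    · have := h.one_sub_two
      simp only [Fin.reduceFinMk] at this ⊢
      rw [this, b₂']
      field_simp
  · refine ⟨a₃.trans ?_, ?_⟩
    · have := h.ftTuple_three
      simp only [Fin.reduceFinMk] at this ⊢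
      rw [this]
      field_simp
    · have := h.one_sub_three
      simp only [Fin.reduceFinMk] at this ⊢
      rw [this, b₃]
      field_simp
  · refine ⟨a₄.trans ?_, ?_⟩
    · simp only [ftTuple, Matrix.cons_val, Fin.reduceFinMk]
      field_simp
    · have := h.one_sub_four
      simp only [Fin.reduceFinMk] at this ⊢
      rw [this, b₄]
      field_simp

end Adm

/-- A straight segment from `(x, y)` to `(x', y')` in the parameter space along which all
relevant logarithms can be continued by the principal branch. -/
structure SlitRel (x y x' y' : ℂ) : Prop where
  fst : x' / x ∈ slitPlane
  snd : y' / y ∈ slitPlane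
  one_sub_fst : (1 - x') / (1 - x) ∈ slitPlane
  one_sub_snd : (1 - y') / (1 - y) ∈ slitPlane
  sub : (x' - y') / (x - y) ∈ slitPlane

lemma exp_two_mul_log {u : ℂ} (hu : u ≠ 0) : exp (2 * log u) = u ^ 2 := by
  rw [two_mul, exp_add, exp_log hu, sq]

/-- Lifting a straight segment in the parameter space. -/
lemma exists_segment_lift {x y x' y' : ℂ} (h : Adm x y) (hs : SlitRel x y x' y')
    {w : Fin 5 → ℂ × ℂ} (hw : ∀ i, LiesOver (w i) (ftTuple x y i)) (hl : FiveTermLinear w) :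
    ∃ (γ : ℝ → Fin 5 → ℂ × ℂ) (U : Set ℝ), IsOpen U ∧ Set.Icc 0 1 ⊆ U ∧ γ 0 = w ∧
      (∀ t ∈ U, γ t ∈ FTpre ∧ FiveTermLinear (γ t) ∧ DifferentiableAt ℝ γ t) ∧
      ∀ i, LiesOver (γ 1 i) (ftTuple x' y' i) := by
  let s : ℂ → ℝ → ℂ := fun u t => 1 + t * (u - 1)
  have hsc : ∀ u, Continuous (s u) := fun u => by fun_prop
  have hs0 : ∀ u, s u 0 = 1 := fun u => by simp [s]
  have hs1 : ∀ u, s u 1 = u := fun u => by simp [s]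
  let U : Set ℝ := s (x' / x) ⁻¹' slitPlane ∩ s (y' / y) ⁻¹' slitPlane ∩
    s ((1 - x') / (1 - x)) ⁻¹' slitPlane ∩ s ((1 - y') / (1 - y)) ⁻¹' slitPlane ∩
    s ((x' - y') / (x - y)) ⁻¹' slitPlane
  let A : ℝ → ℂ := fun t => log (s (x' / x) t)
  let B : ℝ → ℂ := fun t => log (s (y' / y) t)
  let C : ℝ → ℂ := fun t => -log (s ((1 - x') / (1 - x)) t)
  let D : ℝ → ℂ := fun t => -log (s ((1 - y') / (1 - y)) t)
  let E : ℝ → ℂ := fun t => A t - log (s ((x' - y') / (x - y)) t)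
  let γ : ℝ → Fin 5 → ℂ × ℂ := fun t =>
    ![((w 0).1 + A t, (w 0).2 + C t), ((w 1).1 + B t, (w 1).2 + D t),
      ((w 2).1 + (B t - A t), (w 2).2 + E t),
      ((w 3).1 + (B t - A t + (D t - C t)), (w 3).2 + (E t - D t)),
      ((w 4).1 + (D t - C t), (w 4).2 + (E t - D t - A t))]
  have hseg : ∀ u ∈ slitPlane, ∀ t ∈ Set.Icc (0 : ℝ) 1, s u t ∈ slitPlane := fun u hu t ht => by
    have := StarConvex.add_smul_mem starConvex_one_slitPlane (x := (1 : ℂ)) (y := u - 1)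
      (by simpa using hu) ht.1 ht.2
    simpa [s] using this
  have hIcc : Set.Icc (0 : ℝ) 1 ⊆ U := fun t ht =>
    ⟨⟨⟨⟨hseg _ hs.fst t ht, hseg _ hs.snd t ht⟩, hseg _ hs.one_sub_fst t ht⟩,
      hseg _ hs.one_sub_snd t ht⟩, hseg _ hs.sub t ht⟩
  have hlin : ∀ t, FiveTermLinear (γ t) := fun t => by
    constructor <;> simp only [γ, Matrix.cons_val]
    · linear_combination hl.fst_two
    · linear_combination hl.fst_three
    · linear_combination hl.fst_four
    · linear_combination hl.snd_three
    · linear_combination hl.snd_four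
  have h1 := h.left.1
  have h2 := h.right.1
  have h3 := h.right.one_sub_ne
  have h4 := h.left.one_sub_ne
  have h5 := h.sub_ne
  have hover : ∀ t ∈ U, Adm (x + t * (x' - x)) (y + t * (y' - y)) ∧
      ∀ i, LiesOver (γ t i) (ftTuple (x + t * (x' - x)) (y + t * (y' - y)) i) := by
    rintro t ⟨⟨⟨⟨m0, m1⟩, m2⟩, m3⟩, m4⟩
    replace m0 := slitPlane_ne_zero m0
    replace m1 := slitPlane_ne_zero m1
    replace m2 := slitPlane_ne_zero m2
    replace m3 := slitPlane_ne_zero m3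
    replace m4 := slitPlane_ne_zero m4
    have e0 : x + t * (x' - x) = x * s (x' / x) t := by simp only [s]; field_simp
    have e1 : y + t * (y' - y) = y * s (y' / y) t := by simp only [s]; field_simp
    have e2 : 1 - (x + t * (x' - x)) = (1 - x) * s ((1 - x') / (1 - x)) t := by
      simp only [s]; field_simp; ring
    have e3 : 1 - (y + t * (y' - y)) = (1 - y) * s ((1 - y') / (1 - y)) t := by
      simp only [s]; field_simp; ring
    have e4 : (x + t * (x' - x)) - (y + t * (y' - y)) = (x - y) * s ((x' - y') / (x - y)) t := by
      simp only [s]; field_simp; ring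
    have key : ∀ z : ℂ, z ≠ 0 → 1 - z ≠ 0 → Reg z :=
      fun z a b => ⟨a, fun e => b (by rw [e, sub_self])⟩
    have hadm : Adm (x + t * (x' - x)) (y + t * (y' - y)) :=
      ⟨key _ (e0 ▸ mul_ne_zero h1 m0) (e2 ▸ mul_ne_zero h4 m2),
        key _ (e1 ▸ mul_ne_zero h2 m1) (e3 ▸ mul_ne_zero h3 m3),
        sub_ne_zero.1 (e4 ▸ mul_ne_zero h5 m4)⟩
    obtain ⟨-, a₀, b₀⟩ := liesOver_iff.1 (hw 0)
    obtain ⟨-, a₁, b₁⟩ := liesOver_iff.1 (hw 1)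
    obtain ⟨-, -, b₂⟩ := liesOver_iff.1 (hw 2)
    rw [h.one_sub_two, div_pow, mul_div_assoc', div_eq_one_iff_eq (pow_ne_zero 2 h1)] at b₂
    simp only [ftTuple, Matrix.cons_val] at a₀ b₀ a₁ b₁
    refine ⟨hadm, hadm.liesOver_of_linear (hlin t) ?_ ?_ ?_ ?_ ?_⟩ <;>
      simp only [γ, A, B, C, D, E, Matrix.cons_val, mul_add, mul_sub, exp_add, exp_sub, mul_neg,
        exp_neg, exp_two_mul_log m0, exp_two_mul_log m1, exp_two_mul_log m2, exp_two_mul_log m3,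
        exp_two_mul_log m4]
    · rw [← mul_sub, e0, a₀]; ring
    · rw [← mul_sub, e1, a₁]; ring
    · refine Eq.trans ?_ b₀
      rw [← mul_sub, e2]
      field_simp
    · refine Eq.trans ?_ b₁
      rw [← mul_sub, e3]
      field_simp
    · rw [← mul_sub, ← mul_sub, e4, e0, mul_pow x, ← b₂]; field_simp
  refine ⟨γ, U, ?_, hIcc, ?_, fun t ht => ⟨?_, hlin t, ?_⟩, ?_⟩
  · exact ((((isOpen_slitPlane.preimage (hsc _)).inter (isOpen_slitPlane.preimage (hsc _))).inter
      (isOpen_slitPlane.preimage (hsc _))).inter (isOpen_slitPlane.preimage (hsc _))).inter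
      (isOpen_slitPlane.preimage (hsc _))
  · funext i
    fin_cases i <;> simp [γ, A, B, C, D, E, hs0]
  · exact ⟨_, (hover t ht).1.ftTuple_mem, (hover t ht).2⟩
  · obtain ⟨⟨⟨⟨m0, m1⟩, m2⟩, m3⟩, m4⟩ := ht
    have dl : ∀ u, s u t ∈ slitPlane → DifferentiableAt ℝ (fun t => log (s u t)) t := fun u hu =>
      ((differentiableAt_log hu).restrictScalars ℝ).comp t
        (by simp only [s]; exact ((differentiableAt_const _).add
          ((ofRealCLM.differentiableAt).mul (differentiableAt_const _))))
    have dA : DifferentiableAt ℝ A t := dl _ m0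
    have dB : DifferentiableAt ℝ B t := dl _ m1
    have dC : DifferentiableAt ℝ C t := (dl _ m2).neg
    have dD : DifferentiableAt ℝ D t := (dl _ m3).neg
    have dE : DifferentiableAt ℝ E t := dA.sub (dl _ m4)
    refine differentiableAt_pi.2 fun i => ?_
    fin_cases i <;> simp only [γ, Matrix.cons_val, Fin.reduceFinMk, Fin.zero_eta, Fin.mk_one] <;> fun_prop
  · have := (hover 1 (hIcc ⟨zero_le_one, le_rfl⟩)).2
    simpa using this

lemma SlitRel.adm {x y x' y' : ℂ} (hs : SlitRel x y x' y') : Adm x' y' :=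
  ⟨⟨fun e => slitPlane_ne_zero hs.fst (by rw [e, zero_div]),
      fun e => slitPlane_ne_zero hs.one_sub_fst (by rw [e, sub_self, zero_div])⟩,
    ⟨fun e => slitPlane_ne_zero hs.snd (by rw [e, zero_div]),
      fun e => slitPlane_ne_zero hs.one_sub_snd (by rw [e, sub_self, zero_div])⟩,
    fun e => slitPlane_ne_zero hs.sub (by rw [e, sub_self, zero_div])⟩

lemma inv_mem_slitPlane {z : ℂ} (hz : z ∈ slitPlane) : z⁻¹ ∈ slitPlane := by
  have hn : 0 < normSq z := normSq_pos.2 (slitPlane_ne_zero hz)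
  rw [mem_slitPlane_iff] at hz ⊢
  rw [inv_re, inv_im]
  exact hz.imp (fun h => div_pos h hn) (fun h => div_ne_zero (neg_ne_zero.2 h) hn.ne')

lemma SlitRel.symm {x y x' y' : ℂ} (hs : SlitRel x y x' y') : SlitRel x' y' x y where
  fst := by simpa using inv_mem_slitPlane hs.fst
  snd := by simpa using inv_mem_slitPlane hs.snd
  one_sub_fst := by simpa using inv_mem_slitPlane hs.one_sub_fst
  one_sub_snd := by simpa using inv_mem_slitPlane hs.one_sub_snd
  sub := by simpa using inv_mem_slitPlane hs.sub

lemma dense_slitPlane : Dense slitPlane := by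
  have h : Dense {z : ℂ | z.im ≠ 0} :=
    (dense_compl_singleton (0 : ℝ)).preimage (f := Complex.im) isOpenMap_im
  exact h.mono fun z hz => mem_slitPlane_iff.2 (Or.inr hz)

lemma dense_div_mem_slitPlane {X : Type*} [TopologicalSpace X] {f : X → ℂ} (hf : Continuous f)
    (ho : IsOpenMap f) {c : ℂ} (hc : c ≠ 0) :
    IsOpen {p | f p / c ∈ slitPlane} ∧ Dense {p | f p / c ∈ slitPlane} := by
  refine ⟨isOpen_slitPlane.preimage (hf.div_const c), dense_slitPlane.preimage
    (f := fun p => f p / c) ?_⟩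
  have : IsOpenMap fun z : ℂ => z / c := by
    simp only [div_eq_mul_inv]
    exact (Homeomorph.mulRight₀ c⁻¹ (inv_ne_zero hc)).isOpenMap
  exact this.comp ho

/-- The parameters reachable from a given one by a straight segment are generic. -/
lemma slitRel_open_dense {x y : ℂ} (h : Adm x y) :
    IsOpen {m : ℂ × ℂ | SlitRel x y m.1 m.2} ∧ Dense {m : ℂ × ℂ | SlitRel x y m.1 m.2} := by
  have hsub : IsOpenMap fun z : ℂ => 1 - z := (Homeomorph.subLeft (1 : ℂ)).isOpenMap
  have hdiff : IsOpenMap fun m : ℂ × ℂ => m.1 - m.2 :=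
    (ContinuousLinearMap.fst ℂ ℂ ℂ - ContinuousLinearMap.snd ℂ ℂ ℂ).isOpenMap
      fun z => ⟨(z, 0), by simp⟩
  have d0 := dense_div_mem_slitPlane (X := ℂ × ℂ) continuous_fst isOpenMap_fst h.left.1
  have d1 := dense_div_mem_slitPlane (X := ℂ × ℂ) continuous_snd isOpenMap_snd h.right.1
  have d2 := dense_div_mem_slitPlane (X := ℂ × ℂ) (f := fun m => 1 - m.1) (by fun_prop)
    (hsub.comp isOpenMap_fst) h.left.one_sub_ne
  have d3 := dense_div_mem_slitPlane (X := ℂ × ℂ) (f := fun m => 1 - m.2) (by fun_prop)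
    (hsub.comp isOpenMap_snd) h.right.one_sub_ne
  have d4 := dense_div_mem_slitPlane (X := ℂ × ℂ) (f := fun m => m.1 - m.2) (by fun_prop)
    hdiff h.sub_ne
  have e : {m : ℂ × ℂ | SlitRel x y m.1 m.2} =
      {m | m.1 / x ∈ slitPlane} ∩ {m | m.2 / y ∈ slitPlane} ∩
        {m | (1 - m.1) / (1 - x) ∈ slitPlane} ∩ {m | (1 - m.2) / (1 - y) ∈ slitPlane} ∩
        {m | (m.1 - m.2) / (x - y) ∈ slitPlane} := by
    ext m
    exact ⟨fun hs => ⟨⟨⟨⟨hs.fst, hs.snd⟩, hs.one_sub_fst⟩, hs.one_sub_snd⟩, hs.sub⟩,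
      fun ⟨⟨⟨⟨h0, h1⟩, h2⟩, h3⟩, h4⟩ => ⟨h0, h1, h2, h3, h4⟩⟩
  rw [e]
  exact ⟨(((d0.1.inter d1.1).inter d2.1).inter d3.1).inter d4.1,
    (((d0.2.inter_of_isOpen_right d1.2 d1.1).inter_of_isOpen_right d2.2 d2.1).inter_of_isOpen_right
      d3.2 d3.1).inter_of_isOpen_right d4.2 d4.1⟩

lemma exists_slitRel_slitRel {x y x' y' : ℂ} (h : Adm x y) (h' : Adm x' y') :
    ∃ u v, SlitRel x y u v ∧ SlitRel u v x' y' := by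
  obtain ⟨o, d⟩ := slitRel_open_dense h
  obtain ⟨o', d'⟩ := slitRel_open_dense h'
  obtain ⟨m, hm, hm'⟩ := (d.inter_of_isOpen_right d' o').nonempty
  exact ⟨m.1, m.2, hm, SlitRel.symm hm'⟩

lemma mem_FTpre_iff {w : Fin 5 → ℂ × ℂ} :
    w ∈ FTpre ↔ ∃ x y, Adm x y ∧ ∀ i, LiesOver (w i) (ftTuple x y i) := by
  constructor
  · rintro ⟨_, ⟨x, y, hx, hy, hxy, rfl⟩, hw⟩
    exact ⟨x, y, ⟨hx, hy, hxy⟩, hw⟩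
  · rintro ⟨x, y, h, hw⟩
    exact ⟨_, h.ftTuple_mem, hw⟩

lemma mem_FThat₀_of_slitRel {x y x' y' : ℂ} (h : Adm x y) (hs : SlitRel x y x' y')
    {w : Fin 5 → ℂ × ℂ} (hw : ∀ i, LiesOver (w i) (ftTuple x y i)) (hl : FiveTermLinear w)
    (hw₀ : w ∈ FThat₀) :
    ∃ w' ∈ FThat₀, (∀ i, LiesOver (w' i) (ftTuple x' y' i)) ∧ FiveTermLinear w' := by
  obtain ⟨γ, U, -, hU, h0, hγ, h1⟩ := exists_segment_lift h hs hw hl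
  have hc : IsPreconnected (γ '' Set.Icc 0 1) := isPreconnected_Icc.image _ fun t ht =>
    (hγ t (hU ht)).2.2.continuousAt.continuousWithinAt
  have hsub : γ '' Set.Icc 0 1 ⊆ FThat₀ := by
    rw [FThat₀, connectedComponentIn_eq hw₀]
    refine hc.subset_connectedComponentIn ⟨0, ⟨le_rfl, zero_le_one⟩, h0⟩ ?_
    rintro _ ⟨t, ht, rfl⟩
    exact (hγ t (hU ht)).1
  exact ⟨γ 1, hsub ⟨1, ⟨zero_le_one, le_rfl⟩, rfl⟩, h1, (hγ 1 (hU ⟨zero_le_one, le_rfl⟩)).2.1⟩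

lemma adm_base : Adm ((1 + I) / 4) I := by
  refine ⟨⟨?_, ?_⟩, ⟨I_ne_zero, ?_⟩, ?_⟩ <;> intro e
  · have := congrArg Complex.im e; norm_num at this
  · have := congrArg Complex.im e; norm_num at this
  · have := congrArg Complex.im e; norm_num at this
  · have := congrArg Complex.re e; norm_num at this

lemma ftTuple_base_mem_UHP (i : Fin 5) : 0 < (ftTuple ((1 + I) / 4) I i).im := by
  fin_cases i
  · simp [ftTuple]
  · simp [ftTuple]
  · have : ftTuple ((1 + I) / 4) I 2 = 2 + 2 * I := by
      have h := adm_base.left.1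
      simp only [ftTuple, Matrix.cons_val]
      rw [div_eq_iff h]
      ring_nf
      rw [I_sq]
      ring
    simp only [Fin.reduceFinMk, this]
    simp
  · have : ftTuple ((1 + I) / 4) I 3 = (1 + 3 * I) / 2 := by
      have h := adm_base.left.1
      rw [adm_base.ftTuple_three, div_eq_iff (mul_ne_zero h adm_base.right.one_sub_ne)]
      linear_combination (-1 / 8 + 3 / 8 * I) * I_sq
    simp only [Fin.reduceFinMk, this]
    simp
  · have : ftTuple ((1 + I) / 4) I 4 = (2 + I) / 4 := by
      simp only [ftTuple, Matrix.cons_val]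
      rw [div_eq_iff adm_base.right.one_sub_ne]
      linear_combination (1 / 4) * I_sq
    simp only [Fin.reduceFinMk, this]
    simp

lemma log_im_mem_of_im_pos {z : ℂ} (hz : 0 < z.im) : 0 < (log z).im ∧ (log z).im < Real.pi := by
  rw [log_im]
  refine ⟨lt_of_le_of_ne (arg_nonneg_iff.2 hz.le) fun e => ?_, (arg_lt_pi_iff.2 (Or.inr hz.ne'))⟩
  exact hz.ne' (arg_eq_zero_iff.1 e.symm).2

lemma log_one_sub_im_mem_of_im_pos {z : ℂ} (hz : 0 < z.im) :
    -Real.pi < (log (1 - z)).im ∧ (log (1 - z)).im < 0 := by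
  rw [log_im]
  exact ⟨neg_pi_lt_arg _, arg_neg_iff.2 (by simpa using hz)⟩

lemma eq_zero_of_exp_eq_one {u : ℂ} (h : exp u = 1) (h1 : -(2 * Real.pi) < u.im)
    (h2 : u.im < 2 * Real.pi) : u = 0 := by
  obtain ⟨n, rfl⟩ := exp_eq_one_iff.1 h
  simp only [mul_im, intCast_re, intCast_im, mul_re, I_im, I_re, ofReal_im, ofReal_re, re_ofNat,
    im_ofNat] at h1 h2
  have hp := Real.pi_pos
  have n1 : (n : ℝ) < 1 := by nlinarith
  have n2 : (-1 : ℝ) < n := by nlinarith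
  have : n = 0 := by
    have m1 : n < 1 := by exact_mod_cast n1
    have m2 : -1 < n := by exact_mod_cast n2
    omega
  simp [this]

lemma fiveTermLinear_basePt : FiveTermLinear basePt := by
  have hr := adm_base.reg_ftTuple
  have e2 : ftTuple ((1 + I) / 4) I 2 * ftTuple ((1 + I) / 4) I 0 = ftTuple ((1 + I) / 4) I 1 := by
    simp only [ftTuple, Matrix.cons_val]
    exact div_mul_cancel₀ _ adm_base.left.1
  have e4 : ftTuple ((1 + I) / 4) I 4 * (1 - ftTuple ((1 + I) / 4) I 1) =
      1 - ftTuple ((1 + I) / 4) I 0 := by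
    have := adm_base.right.one_sub_ne
    simp only [ftTuple, Matrix.cons_val]
    field_simp
  have e3 : ftTuple ((1 + I) / 4) I 3 =
      ftTuple ((1 + I) / 4) I 2 * ftTuple ((1 + I) / 4) I 4 := by
    rw [adm_base.ftTuple_three]
    simp only [ftTuple, Matrix.cons_val]
    rw [div_mul_div_comm]
  have e5 : (1 - ftTuple ((1 + I) / 4) I 3) * (1 - ftTuple ((1 + I) / 4) I 1) =
      1 - ftTuple ((1 + I) / 4) I 2 := by
    have h1 := adm_base.left.1
    have h2 := adm_base.right.one_sub_ne
    rw [adm_base.one_sub_three, adm_base.one_sub_two]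
    simp only [ftTuple, Matrix.cons_val]
    rw [div_mul_eq_mul_div, mul_div_mul_right _ _ h2]
  have e6 : 1 - ftTuple ((1 + I) / 4) I 4 =
      (1 - ftTuple ((1 + I) / 4) I 3) * ftTuple ((1 + I) / 4) I 0 := by
    have h1 := adm_base.left.1
    have h2 := adm_base.right.one_sub_ne
    rw [adm_base.one_sub_three, adm_base.one_sub_four]
    simp only [ftTuple, Matrix.cons_val]
    rw [div_mul_eq_mul_div, mul_comm ((1 + I) / 4) (1 - I), mul_div_mul_right _ _ h1]
  have la := fun i => log_im_mem_of_im_pos (ftTuple_base_mem_UHP i)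
  have lb := fun i => log_one_sub_im_mem_of_im_pos (ftTuple_base_mem_UHP i)
  have hbp : ∀ i, basePt i = (log (ftTuple ((1 + I) / 4) I i),
      -log (1 - ftTuple ((1 + I) / 4) I i)) := fun i => by simp [basePt, pt]
  revert hr e2 e3 e4 e5 e6 la lb hbp
  generalize ftTuple ((1 + I) / 4) I = z
  intro hr e2 e4 e3 e5 e6 la lb hbp
  have key : ∀ a b c : ℂ, a ≠ 0 → b ≠ 0 → a * b = c →
      -(2 * Real.pi) < (log a + log b - log c).im → (log a + log b - log c).im < 2 * Real.pi →
      log a + log b = log c := fun a b c ha hb h h1 h2 => by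
    refine sub_eq_zero.1 (eq_zero_of_exp_eq_one ?_ h1 h2)
    rw [exp_sub, exp_add, exp_log ha, exp_log hb, h, exp_log (h ▸ mul_ne_zero ha hb),
      div_self (h ▸ mul_ne_zero ha hb)]
  have n := fun i => (hr i).1
  have m := fun i => (hr i).one_sub_ne
  have k2 := key _ _ _ (n 2) (n 0) e2 (by
    simp only [sub_im, add_im]; linarith [la 0, la 1, la 2]) (by
    simp only [sub_im, add_im]; linarith [la 0, la 1, la 2])
  have k4 := key _ _ _ (n 4) (m 1) e4 (by
    simp only [sub_im, add_im]; linarith [la 4, lb 1, lb 0]) (by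
    simp only [sub_im, add_im]; linarith [la 4, lb 1, lb 0])
  have k3 := key _ _ _ (n 2) (n 4) e3.symm (by
    simp only [sub_im, add_im]; linarith [la 2, la 3, la 4]) (by
    simp only [sub_im, add_im]; linarith [la 2, la 3, la 4])
  have k5 := key _ _ _ (m 3) (m 1) e5 (by
    simp only [sub_im, add_im]; linarith [lb 1, lb 2, lb 3]) (by
    simp only [sub_im, add_im]; linarith [lb 1, lb 2, lb 3])
  have k6 := key _ _ _ (m 3) (n 0) e6.symm (by
    simp only [sub_im, add_im]; linarith [lb 3, lb 4, la 0]) (by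
    simp only [sub_im, add_im]; linarith [lb 3, lb 4, la 0])
  constructor <;> simp only [hbp]
  · linear_combination k2
  · linear_combination -k3
  · linear_combination k4
  · linear_combination -k5
  · linear_combination k6

lemma liesOver_basePt (i : Fin 5) : LiesOver (basePt i) (ftTuple ((1 + I) / 4) I i) :=
  liesOver_pt (adm_base.reg_ftTuple i) 0 0

lemma basePt_mem_FThat₀ : basePt ∈ FThat₀ :=
  mem_connectedComponentIn ⟨_, adm_base.ftTuple_mem, liesOver_basePt⟩

lemma exists_mem_FThat₀ {x y : ℂ} (h : Adm x y) :
    ∃ w ∈ FThat₀, (∀ i, LiesOver (w i) (ftTuple x y i)) ∧ FiveTermLinear w := by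
  obtain ⟨u, v, h1, h2⟩ := exists_slitRel_slitRel adm_base h
  obtain ⟨w, hw, ho, hl⟩ := mem_FThat₀_of_slitRel adm_base h1 liesOver_basePt
    fiveTermLinear_basePt basePt_mem_FThat₀
  exact mem_FThat₀_of_slitRel h1.adm h2 ho hl hw

lemma eq_zero_of_mem_FThat₀ {f : (Fin 5 → ℂ × ℂ) → ℂ} (hf : Continuous f)
    (he : ∀ w ∈ FTpre, exp (2 * f w) = 1) (h0 : f basePt = 0) {w : Fin 5 → ℂ × ℂ}
    (hw : w ∈ FThat₀) : f w = 0 := by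
  have hT : (Set.range fun n : ℤ => (n : ℂ) * (Cpi * I)).Countable := Set.countable_range _
  have hpre : IsPreconnected (f '' FThat₀) :=
    isPreconnected_connectedComponentIn.image f hf.continuousOn
  have hsub : f '' FThat₀ ⊆ Set.range fun n : ℤ => (n : ℂ) * (Cpi * I) := by
    rintro _ ⟨u, hu, rfl⟩
    obtain ⟨n, hn⟩ := exists_int_of_exp_two_mul (he u (connectedComponentIn_subset _ _ hu))
    exact ⟨n, hn.symm⟩
  rw [← h0]
  exact hT.isTotallyDisconnected _ hsub hpre ⟨w, hw, rfl⟩ ⟨basePt, basePt_mem_FThat₀, rfl⟩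

/-- The exponentials of all coordinates of a point in the preimage of `FT`. -/
lemma exp_coordinates {w : Fin 5 → ℂ × ℂ} (hw : w ∈ FTpre) :
    exp (2 * (w 1).1) = exp (2 * (w 2).1) * exp (2 * (w 0).1) ∧
    exp (2 * (w 3).1) = exp (2 * (w 2).1) * exp (2 * (w 4).1) ∧
    exp (2 * (w 1).2) = exp (2 * (w 4).1) * exp (2 * (w 0).2) ∧
    exp (2 * (w 2).2) = exp (2 * (w 3).2) * exp (2 * (w 1).2) ∧
    exp (2 * (w 3).2) = exp (2 * (w 4).2) * exp (2 * (w 0).1) := by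
  obtain ⟨x, y, h, hw⟩ := mem_FTpre_iff.1 hw
  have h1 := h.left.1
  have h2 := h.right.1
  have h3 := h.right.one_sub_ne
  have h4 := h.left.one_sub_ne
  have h5 := h.sub_ne
  have ha : ∀ i, exp (2 * (w i).1) = ftTuple x y i ^ 2 := fun i => (liesOver_iff.1 (hw i)).2.1
  have hb : ∀ i, exp (2 * (w i).2) = 1 / (1 - ftTuple x y i) ^ 2 := fun i =>
    eq_div_of_mul_eq (pow_ne_zero 2 (h.reg_ftTuple i).one_sub_ne) (liesOver_iff.1 (hw i)).2.2
  simp only [ha, hb, h.one_sub_two, h.one_sub_three, h.one_sub_four]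
  simp only [h.ftTuple_three]
  simp only [ftTuple, Matrix.cons_val]
  refine ⟨?_, ?_, ?_, ?_, ?_⟩ <;> field_simp

lemma fiveTermLinear_of_mem_FThat₀ {w : Fin 5 → ℂ × ℂ} (hw : w ∈ FThat₀) : FiveTermLinear w := by
  have hb := fiveTermLinear_basePt
  have key : ∀ f : (Fin 5 → ℂ × ℂ) → ℂ, Continuous f → (∀ w ∈ FTpre, exp (2 * f w) = 1) →
      f basePt = 0 → f w = 0 := fun f h1 h2 h3 => eq_zero_of_mem_FThat₀ h1 h2 h3 hw
  constructor
  · have := key (fun w => (w 2).1 + (w 0).1 - (w 1).1) (by fun_prop) (fun w hw => by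
      rw [mul_sub, mul_add, exp_sub, exp_add, (exp_coordinates hw).1]
      exact div_self (mul_ne_zero (exp_ne_zero _) (exp_ne_zero _)))
      (by linear_combination hb.fst_two)
    linear_combination this
  · have := key (fun w => (w 2).1 + (w 4).1 - (w 3).1) (by fun_prop) (fun w hw => by
      rw [mul_sub, mul_add, exp_sub, exp_add, (exp_coordinates hw).2.1]
      exact div_self (mul_ne_zero (exp_ne_zero _) (exp_ne_zero _)))
      (by linear_combination -hb.fst_three)
    linear_combination -this
  · have := key (fun w => (w 4).1 + (w 0).2 - (w 1).2) (by fun_prop) (fun w hw => by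
      rw [mul_sub, mul_add, exp_sub, exp_add, (exp_coordinates hw).2.2.1]
      exact div_self (mul_ne_zero (exp_ne_zero _) (exp_ne_zero _)))
      (by linear_combination hb.fst_four)
    linear_combination this
  · have := key (fun w => (w 3).2 + (w 1).2 - (w 2).2) (by fun_prop) (fun w hw => by
      rw [mul_sub, mul_add, exp_sub, exp_add, (exp_coordinates hw).2.2.2.1]
      exact div_self (mul_ne_zero (exp_ne_zero _) (exp_ne_zero _)))
      (by linear_combination hb.snd_three)
    linear_combination this
  · have := key (fun w => (w 4).2 + (w 0).1 - (w 3).2) (by fun_prop) (fun w hw => by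
      rw [mul_sub, mul_add, exp_sub, exp_add, (exp_coordinates hw).2.2.2.2]
      exact div_self (mul_ne_zero (exp_ne_zero _) (exp_ne_zero _)))
      (by linear_combination hb.snd_four)
    linear_combination this

lemma FiveTermLinear.covAct {w : Fin 5 → ℂ × ℂ} (hw : FiveTermLinear w) {v : Fin 5 → ℤ × ℤ}
    (hv : v ∈ Vset) : FiveTermLinear fun i => covAct (v i) (w i) := by
  obtain ⟨p₀, p₁, q₀, q₁, q₂, rfl⟩ := hv
  constructor <;> simp only [ExtendedBloch.covAct, Matrix.cons_val] <;> push_cast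
  · linear_combination hw.fst_two
  · linear_combination hw.fst_three
  · linear_combination hw.fst_four
  · linear_combination hw.snd_three
  · linear_combination hw.snd_four

/-- Two lifts of the same five term tuple satisfying the linear relations differ by `V`. -/
lemma exists_Vset {w w' : Fin 5 → ℂ × ℂ} {z : Fin 5 → ℂ} (hw : ∀ i, LiesOver (w i) (z i))
    (hw' : ∀ i, LiesOver (w' i) (z i)) (hl : FiveTermLinear w) (hl' : FiveTermLinear w') :
    ∃ v ∈ Vset, w' = fun i => covAct (v i) (w i) := by
  have hv : ∀ i, ∃ v : ℤ × ℤ, w' i = covAct v (w i) := fun i => by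
    obtain ⟨-, p, q, e⟩ := hw i
    obtain ⟨-, p', q', e'⟩ := hw' i
    exact ⟨(p' - p, q' - q), by rw [e, e', covAct_pt]; congr <;> ring⟩
  choose v hv using hv
  refine ⟨v, ?_, funext hv⟩
  have cancel : ∀ m n : ℤ, (m : ℂ) * (Cpi * I) = n * (Cpi * I) → m = n := fun m n h =>
    Int.cast_injective (mul_right_cancel₀ Cpi_mul_I_ne_zero h)
  have a : ∀ i, (w' i).1 = (w i).1 + (v i).1 * (Cpi * I) := fun i => by rw [hv i]; rfl
  have b : ∀ i, (w' i).2 = (w i).2 + (v i).2 * (Cpi * I) := fun i => by rw [hv i]; rfl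
  have l2 := hl'.fst_two
  have l3 := hl'.fst_three
  have l4 := hl'.fst_four
  have m3 := hl'.snd_three
  have m4 := hl'.snd_four
  simp only [a, b] at l2 l3 l4 m3 m4
  have c2 := cancel (v 2).1 ((v 1).1 - (v 0).1) (by
    push_cast; linear_combination l2 - hl.fst_two)
  have c3 := cancel (v 3).1 ((v 2).1 + (v 4).1) (by
    push_cast; linear_combination l3 - hl.fst_three)
  have c4 := cancel (v 4).1 ((v 1).2 - (v 0).2) (by
    push_cast; linear_combination l4 - hl.fst_four)
  have d3 := cancel (v 3).2 ((v 2).2 - (v 1).2) (by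
    push_cast; linear_combination m3 - hl.snd_three)
  have d4 := cancel (v 4).2 ((v 3).2 - (v 0).1) (by
    push_cast; linear_combination m4 - hl.snd_four)
  refine ⟨(v 0).1, (v 1).1, (v 0).2, (v 1).2, (v 2).2, funext fun i => ?_⟩
  fin_cases i
  · rfl
  · rfl
  · exact Prod.ext c2 rfl
  · refine Prod.ext ?_ d3
    simp only [Fin.reduceFinMk, Matrix.cons_val]
    omega
  · refine Prod.ext c4 ?_
    simp only [Fin.reduceFinMk, Matrix.cons_val]
    omega

lemma mem_FThat_iff {w : Fin 5 → ℂ × ℂ} : w ∈ FThat ↔ w ∈ FTpre ∧ FiveTermLinear w := by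
  constructor
  · rintro ⟨w, hw, v, hv, rfl⟩
    obtain ⟨z, hz, ho⟩ := connectedComponentIn_subset _ _ hw
    exact ⟨⟨z, hz, fun i => (ho i).covAct (v i)⟩, (fiveTermLinear_of_mem_FThat₀ hw).covAct hv⟩
  · rintro ⟨hw, hl⟩
    obtain ⟨x, y, h, ho⟩ := mem_FTpre_iff.1 hw
    obtain ⟨w', hw', ho', hl'⟩ := exists_mem_FThat₀ h
    obtain ⟨v, hv, e⟩ := exists_Vset ho' ho hl' hl
    exact ⟨w', hw', v, hv, e⟩

/-- All lifts of the five term relation over a given pair of parameters. -/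
lemma exists_five_term_lift {x y : ℂ} (h : Adm x y) :
    ∃ P Q : Fin 5 → ℤ, ∀ v ∈ Vset,
      (fun i => pt (ftTuple x y i) (P i + (v i).1) (Q i + (v i).2)) ∈ FThat := by
  obtain ⟨w, hw, ho, -⟩ := exists_mem_FThat₀ h
  choose _ P Q hPQ using ho
  refine ⟨P, Q, fun v hv => ⟨w, hw, v, hv, funext fun i => ?_⟩⟩
  rw [hPQ i, covAct_pt]

/-! ### The dilogarithm -/

/-- A holomorphic function on a convex open set has a primitive. -/
lemma exists_primitive_of_convex {s : Set ℂ} (hs : Convex ℝ s) (ho : IsOpen s) {g : ℂ → ℂ}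
    (hg : DifferentiableOn ℂ g s) : ∃ f : ℂ → ℂ, ∀ a ∈ s, HasDerivAt f (g a) a := by
  let T : ℂ →L[ℂ] ℂ →L[ℂ] ℂ := ContinuousLinearMap.mul ℂ ℂ
  have hT : ∀ a ∈ s, HasFDerivAt (𝕜 := ℝ) (fun z => T (g z))
      ((T.restrictScalars ℝ).comp
        ((ContinuousLinearMap.toSpanSingleton ℂ (deriv g a)).restrictScalars ℝ)) a := by
    intro a ha
    have h1 := ((hg a ha).differentiableAt (ho.mem_nhds ha)).hasDerivAt.hasFDerivAt.restrictScalars ℝ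
    exact (T.restrictScalars ℝ).hasFDerivAt.comp a h1
  obtain ⟨f, hf⟩ := hs.exists_forall_hasFDerivAt_of_fderiv_symmetric ho
    (fun a ha => (hT a ha).differentiableAt.differentiableWithinAt) (fun a ha x y => by
      rw [(hT a ha).fderiv]
      simp [T]
      ring)
  refine ⟨f, fun a ha => ?_⟩
  have := (hf a ha).hasDerivAt
  simpa [T] using this

/-- The existence of the dilogarithm on the plane slit along `[1, ∞)`. -/
lemma exists_dilog : ∃ D : ℂ → ℂ, ∀ z, z ≠ 0 → 1 - z ∈ slitPlane →
    HasDerivAt D (-log (1 - z) / z) z := by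
  let l : ℂ → ℂ := fun z => log (1 - z)
  let W : Set ℂ := (fun z => 1 - z) ⁻¹' slitPlane
  have hW : IsOpen W := isOpen_slitPlane.preimage (by fun_prop)
  have hl : DifferentiableOn ℂ l W := fun z hz =>
    (((hasDerivAt_id z).const_sub 1).clog hz).differentiableAt.differentiableWithinAt
  have hg : DifferentiableOn ℂ (dslope l 0) W :=
    (differentiableOn_dslope (hW.mem_nhds (by simp [W]))).2 hl
  let s : Set ℂ := {u | -Real.pi < u.im} ∩ {u | u.im < Real.pi}
  have hs : Convex ℝ s := (convex_halfSpace_im_gt _).inter (convex_halfSpace_im_lt _)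
  have ho : IsOpen s := (isOpen_lt continuous_const continuous_im).inter
    (isOpen_lt continuous_im continuous_const)
  have hm : ∀ u ∈ s, 1 - exp u ∈ W := fun u hu => by
    simp only [W, Set.mem_preimage, sub_sub_cancel]
    rw [mem_slitPlane_iff_arg, ← log_im, log_exp hu.1 hu.2.le]
    exact ⟨hu.2.ne, exp_ne_zero u⟩
  have hh : DifferentiableOn ℂ (fun u => dslope l 0 (1 - exp u) * exp u) s := fun u hu => by
    have h1 := (hg _ (hm u hu)).differentiableAt (hW.mem_nhds (hm u hu))
    have h2 : DifferentiableAt ℂ (fun u => 1 - exp u) u := by fun_prop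
    exact ((h1.comp u h2).mul differentiable_exp.differentiableAt).differentiableWithinAt
  obtain ⟨f, hf⟩ := exists_primitive_of_convex hs ho hh
  refine ⟨fun z => f (log (1 - z)), fun z hz hz1 => ?_⟩
  have hz0 : 1 - z ≠ 0 := slitPlane_ne_zero hz1
  have hls : log (1 - z) ∈ s := by
    refine ⟨neg_pi_lt_log_im _, lt_of_le_of_ne (log_im_le_pi _) ?_⟩
    rw [log_im]
    exact slitPlane_arg_ne_pi hz1
  have := (hf _ hls).comp z (((hasDerivAt_id z).const_sub 1).clog hz1)
  refine this.congr_deriv ?_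
  simp only [id]
  rw [exp_log hz0, sub_sub_cancel, dslope_of_ne _ hz, slope_def_field]
  simp only [l, sub_zero, log_one]
  field_simp

/-- The dilogarithm on the plane slit along `[1, ∞)`, up to a constant. -/
def dilog : ℂ → ℂ := exists_dilog.choose

lemma hasDerivAt_dilog {z : ℂ} (hz : z ≠ 0) (hz1 : 1 - z ∈ slitPlane) :
    HasDerivAt dilog (-log (1 - z) / z) z :=
  exists_dilog.choose_spec z hz hz1

/-- The constant in the reflection formula of `dilog`. -/
def dilogConst : ℂ := dilog (1 / 2) + dilog (1 - 1 / 2) + log (1 / 2) * log (1 - 1 / 2)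

lemma starConvex_half_slitPlane : StarConvex ℝ (1 / 2) slitPlane := by
  intro z hz a b ha hb hab
  rw [mem_slitPlane_iff] at hz ⊢
  have e1 : (a • (1 / 2 : ℂ) + b • z).re = a / 2 + b * z.re := by simp; ring
  have e2 : (a • (1 / 2 : ℂ) + b • z).im = b * z.im := by simp
  rw [e1, e2]
  rcases hb.eq_or_lt with rfl | hb
  · left; linarith
  · rcases hz with h | h
    · left; nlinarith [mul_pos hb h]
    · exact Or.inr (mul_ne_zero hb.ne' h)

lemma dilog_reflection {z : ℂ} (hz : z ∈ slitPlane) (hz1 : 1 - z ∈ slitPlane) :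
    dilog z + dilog (1 - z) + log z * log (1 - z) = dilogConst := by
  let O : Set ℂ := slitPlane ∩ (fun z => 1 - z) ⁻¹' slitPlane
  have hO : IsOpen O := isOpen_slitPlane.inter (isOpen_slitPlane.preimage (by fun_prop))
  have hh : (1 / 2 : ℂ) ∈ slitPlane := by
    rw [mem_slitPlane_iff]; left; norm_num
  have hO2 : (1 / 2 : ℂ) ∈ O := ⟨hh, show 1 - (1 / 2 : ℂ) ∈ slitPlane by
    rwa [show 1 - (1 / 2 : ℂ) = 1 / 2 by norm_num]⟩
  have hstar : StarConvex ℝ (1 / 2) O := by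
    intro z hz a b ha hb hab
    refine ⟨starConvex_half_slitPlane hz.1 ha hb hab, ?_⟩
    have hab' : (a : ℂ) + b = 1 := by exact_mod_cast hab
    have e : 1 - (a • (1 / 2 : ℂ) + b • z) = a • (1 / 2 : ℂ) + b • (1 - z) := by
      simp only [real_smul]
      linear_combination -hab'
    rw [Set.mem_preimage, e]
    exact starConvex_half_slitPlane hz.2 ha hb hab
  have hc : IsPreconnected O :=
    (hstar.isPathConnected hO2).isConnected.isPreconnected
  have hd : ∀ z ∈ O, HasDerivAt (fun z => dilog z + dilog (1 - z) + log z * log (1 - z)) 0 z := by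
    rintro z ⟨h1, h2⟩
    have n1 := slitPlane_ne_zero h1
    have n2 := slitPlane_ne_zero h2
    have d1 := hasDerivAt_dilog n1 h2
    have d0 := (hasDerivAt_id z).const_sub 1
    have d2 := (hasDerivAt_dilog n2 (by simpa using h1)).comp z d0
    refine ((d1.add d2).add ((hasDerivAt_log h1).mul (d0.clog h2))).congr_deriv ?_
    simp only [id, sub_sub_cancel]
    field_simp
    ring
  exact hO.is_const_of_deriv_eq_zero hc
    (fun z hz => (hd z hz).differentiableAt.differentiableWithinAt) (fun z hz => (hd z hz).deriv)
    (x := z) (y := 1 / 2) ⟨hz, hz1⟩ hO2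

/-! ### The dilogarithm character -/

/-- The projection of the cover to the plane. -/
def coverProj (w : ℂ × ℂ) : ℂ := (1 + exp (2 * w.1) - exp (-(2 * w.2))) / 2

lemma LiesOver.coverProj_eq {w : ℂ × ℂ} {z : ℂ} (h : LiesOver w z) : coverProj w = z := by
  obtain ⟨hz, h1, h2⟩ := liesOver_iff.1 h
  have : exp (-(2 * w.2)) = (1 - z) ^ 2 := by
    rw [exp_neg]
    exact inv_eq_of_mul_eq_one_right h2
  rw [coverProj, h1, this]
  ring

/-- The locally constant function `(-1) ^ (p * q)` on the cover. -/
def coverSign (w : ℂ × ℂ) : ℂ :=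
  (1 + exp w.1 / coverProj w + exp w.2 * (1 - coverProj w) -
    exp w.1 / coverProj w * (exp w.2 * (1 - coverProj w))) / 2

lemma exp_int_mul_Cpi (n : ℤ) : exp (n * (Cpi * I)) = (-1) ^ n := by
  rw [exp_int_mul, Cpi, exp_pi_mul_I]

lemma coverSign_pt {z : ℂ} (hz : Reg z) (p q : ℤ) : coverSign (pt z p q) = (-1) ^ (p * q) := by
  have h1 : exp (pt z p q).1 / z = (-1) ^ p := by
    rw [pt, exp_add, exp_log hz.1, exp_int_mul_Cpi, mul_div_cancel_left₀ _ hz.1]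
  have h2 : exp (pt z p q).2 * (1 - z) = (-1) ^ q := by
    rw [pt, exp_add, exp_neg, exp_log hz.one_sub_ne, exp_int_mul_Cpi]
    field_simp [hz.one_sub_ne]
  rw [coverSign, (liesOver_pt hz p q).coverProj_eq, h1, h2]
  rcases Int.even_or_odd p with hp | hp
  · rw [hp.neg_one_zpow, (hp.mul_right q).neg_one_zpow]
    ring
  · rcases Int.even_or_odd q with hq | hq
    · rw [hq.neg_one_zpow, (hq.mul_left p).neg_one_zpow]
      ring
    · rw [hp.neg_one_zpow, hq.neg_one_zpow, (hp.mul hq).neg_one_zpow]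
      norm_num

/-- The exponent of the dilogarithm character over `1 - z ∈ slitPlane`. -/
def rogersOne (z : ℂ) (w : ℂ × ℂ) : ℂ := dilog z + w.1 * w.2 / 2 + w.1 * log (1 - z)

/-- The exponent of the dilogarithm character over `z ∈ slitPlane`. -/
def rogersTwo (z : ℂ) (w : ℂ × ℂ) : ℂ :=
  dilogConst - dilog (1 - z) - w.1 * w.2 / 2 + w.2 * log z

/-- The exponential of `2i/π` times the Rogers dilogarithm on the cover. -/
def dilogChar (w : ℂ × ℂ) : ℂ :=
  exp (2 * I / Cpi * if 1 - coverProj w ∈ slitPlane then rogersOne (coverProj w) w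
    else rogersTwo (coverProj w) w) * coverSign w

lemma Cpi_ne_zero : Cpi ≠ 0 := ofReal_ne_zero.2 Real.pi_ne_zero

lemma dilogChar_eq_one {w : ℂ × ℂ} {z : ℂ} (h : LiesOver w z) (h1 : 1 - z ∈ slitPlane) :
    dilogChar w = exp (2 * I / Cpi * rogersOne z w) * coverSign w := by
  rw [dilogChar, h.coverProj_eq, if_pos h1]

lemma dilogChar_eq_two {w : ℂ × ℂ} {z : ℂ} (h : LiesOver w z) (h0 : z ∈ slitPlane) :
    dilogChar w = exp (2 * I / Cpi * rogersTwo z w) * coverSign w := by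
  rw [dilogChar, h.coverProj_eq]
  split_ifs with h1
  · obtain ⟨hz, p, q, rfl⟩ := h
    congr 1
    have e : 2 * I / Cpi * rogersOne z (pt z p q) =
        2 * I / Cpi * rogersTwo z (pt z p q) + 2 * ((-(p * q) : ℤ) * (Cpi * I)) := by
      rw [rogersOne, rogersTwo, ← dilog_reflection h0 h1, pt]
      have := Cpi_ne_zero
      push_cast
      field_simp
      ring_nf
      rw [I_sq]
      ring
    rw [e, exp_add, exp_int_mul_two_Cpi, mul_one]
  · rfl

lemma mem_slitPlane_or {z : ℂ} : 1 - z ∈ slitPlane ∨ z ∈ slitPlane := by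
  simp only [mem_slitPlane_iff, sub_re, sub_im, one_re, one_im]
  by_cases h : 0 < z.re
  · exact Or.inr (Or.inl h)
  · left; left; linarith

lemma dilogChar_ne_zero {w : ℂ × ℂ} (hw : w ∈ Cover) : dilogChar w ≠ 0 := by
  obtain ⟨z, hz, p, q, rfl⟩ := hw
  rw [dilogChar, coverSign_pt hz]
  exact mul_ne_zero (exp_ne_zero _) (zpow_ne_zero _ (by norm_num))

lemma dilogChar_pt {z : ℂ} (hz : Reg z) (p q : ℤ) :
    dilogChar (pt z p q) = dilogChar (pt z 0 0) * (1 - z) ^ (-p) * z ^ (-q) := by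
  have hs : ((-1 : ℂ) ^ (p * q)) = exp ((p * q : ℤ) * (Cpi * I)) := (exp_int_mul_Cpi _).symm
  have e1 : (1 - z) ^ (-p) = exp ((-p : ℤ) * log (1 - z)) := by
    rw [exp_int_mul, exp_log hz.one_sub_ne]
  have e2 : z ^ (-q) = exp ((-q : ℤ) * log z) := by
    rw [exp_int_mul, exp_log hz.1]
  have hc := Cpi_ne_zero
  rcases mem_slitPlane_or (z := z) with h | h
  · rw [dilogChar_eq_one (liesOver_pt hz p q) h, dilogChar_eq_one (liesOver_pt hz 0 0) h,
      coverSign_pt hz, coverSign_pt hz, hs, e1, e2, mul_zero, zpow_zero, mul_one, ← exp_add,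
      ← exp_add, ← exp_add]
    congr 1
    simp only [rogersOne, pt]
    push_cast
    field_simp
    ring_nf
    simp only [show I ^ 3 = -I by rw [pow_succ, I_sq]; ring, I_sq]
    ring
  · rw [dilogChar_eq_two (liesOver_pt hz p q) h, dilogChar_eq_two (liesOver_pt hz 0 0) h,
      coverSign_pt hz, coverSign_pt hz, hs, e1, e2, mul_zero, zpow_zero, mul_one, ← exp_add,
      ← exp_add, ← exp_add]
    have e3 : exp ((p * q : ℤ) * (Cpi * I)) = exp (-((p * q : ℤ) * (Cpi * I))) := by
      rw [← mul_one (exp (-_)), ← exp_int_mul_two_Cpi (p * q), ← exp_add]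
      congr 1
      ring
    rw [exp_add _ ((p * q : ℤ) * (Cpi * I)), e3, ← exp_add]
    congr 1
    simp only [rogersTwo, pt]
    push_cast
    field_simp
    ring_nf
    simp only [show I ^ 3 = -I by rw [pow_succ, I_sq]; ring, I_sq]
    ring

lemma dilogChar_covAct {w : ℂ × ℂ} {z : ℂ} (h : LiesOver w z) (v : ℤ × ℤ) :
    dilogChar (covAct v w) = dilogChar w * ((1 - z) ^ (-v.1) * z ^ (-v.2)) := by
  obtain ⟨hz, p, q, rfl⟩ := h
  rw [covAct_pt, dilogChar_pt hz (p + v.1), dilogChar_pt hz p, neg_add, neg_add,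
    zpow_add₀ hz.one_sub_ne, zpow_add₀ hz.1]
  ring

/-- The logarithmic derivatives of the projection along a path in the cover. -/
lemma hasDerivAt_coverProj {γ : ℝ → ℂ × ℂ} {γ' : ℂ × ℂ} {t : ℝ}
    (hc : ∀ᶠ s in 𝓝 t, γ s ∈ Cover) (hγ : HasDerivAt γ γ' t) :
    HasDerivAt (fun s => coverProj (γ s)) (γ'.1 * coverProj (γ t)) t ∧
      γ'.1 * coverProj (γ t) = γ'.2 * (1 - coverProj (γ t)) := by
  have ha : HasDerivAt (fun s => (γ s).1) γ'.1 t := hγ.fst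
  have hb : HasDerivAt (fun s => (γ s).2) γ'.2 t := hγ.snd
  have ea := (ha.const_mul (2 : ℂ)).cexp
  have eb : HasDerivAt (fun s => exp (-(2 * (γ s).2)))
      (exp (-(2 * (γ t).2)) * -(2 * γ'.2)) t := (hb.const_mul (2 : ℂ)).neg.cexp
  have hz := ((ea.const_add 1).sub eb).div_const 2
  change HasDerivAt (fun s => coverProj (γ s)) _ t at hz
  obtain ⟨z, hr, hpt⟩ := hc.self_of_nhds
  have hl : LiesOver (γ t) z := ⟨hr, hpt⟩
  have hsq : (fun s => exp (2 * (γ s).1)) =ᶠ[𝓝 t] fun s => coverProj (γ s) ^ 2 := by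
    filter_upwards [hc] with s ⟨u, hu, hpt⟩
    have hl : LiesOver (γ s) u := ⟨hu, hpt⟩
    rw [hl.coverProj_eq, (liesOver_iff.1 hl).2.1]
  have hsq' : (fun s => exp (-(2 * (γ s).2))) =ᶠ[𝓝 t] fun s => (1 - coverProj (γ s)) ^ 2 := by
    filter_upwards [hc] with s ⟨u, hu, hpt⟩
    have hl : LiesOver (γ s) u := ⟨hu, hpt⟩
    rw [hl.coverProj_eq, exp_neg]
    exact inv_eq_of_mul_eq_one_right (liesOver_iff.1 hl).2.2
  have u1 := ea.unique ((hz.pow 2).congr_of_eventuallyEq hsq)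
  have u2 := eb.unique (((hz.const_sub 1).pow 2).congr_of_eventuallyEq hsq')
  have v1 := hsq.self_of_nhds
  have v2 := hsq'.self_of_nhds
  have n1 : coverProj (γ t) ≠ 0 := hl.coverProj_eq ▸ hr.1
  have n2 : 1 - coverProj (γ t) ≠ 0 := hl.coverProj_eq ▸ hr.one_sub_ne
  simp only at u1 u2 v1 v2
  rw [v1, v2] at u1 u2 hz
  have w1 : γ'.1 * coverProj (γ t) = (2 * γ'.1 * coverProj (γ t) ^ 2 +
      2 * γ'.2 * (1 - coverProj (γ t)) ^ 2) / 2 := by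
    apply mul_left_cancel₀ n1
    linear_combination u1 / 2
  have w2 : γ'.2 * (1 - coverProj (γ t)) = (2 * γ'.1 * coverProj (γ t) ^ 2 +
      2 * γ'.2 * (1 - coverProj (γ t)) ^ 2) / 2 := by
    apply mul_left_cancel₀ n2
    linear_combination -u2 / 2
  refine ⟨hz.congr_deriv ?_, w1.trans w2.symm⟩
  rw [w1]
  ring

lemma hasDerivAt_coverSign {γ : ℝ → ℂ × ℂ} {γ' : ℂ × ℂ} {t : ℝ}
    (hc : ∀ᶠ s in 𝓝 t, γ s ∈ Cover) (hγ : HasDerivAt γ γ' t) :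
    HasDerivAt (fun s => coverSign (γ s)) 0 t := by
  have ha : HasDerivAt (fun s => (γ s).1) γ'.1 t := hγ.fst
  have hb : HasDerivAt (fun s => (γ s).2) γ'.2 t := hγ.snd
  obtain ⟨hz, e⟩ := hasDerivAt_coverProj hc hγ
  obtain ⟨z, hr, hpt⟩ := hc.self_of_nhds
  have hl : LiesOver (γ t) z := ⟨hr, hpt⟩
  have n1 : coverProj (γ t) ≠ 0 := hl.coverProj_eq ▸ hr.1
  have h1 := (ha.cexp.div hz n1).congr_deriv (g' := 0) (by ring)
  have h2 := (hb.cexp.mul (hz.const_sub 1)).congr_deriv (g' := 0) (by linear_combination -exp (γ t).2 * e)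
  exact ((((h1.const_add 1).add h2).sub (h1.mul h2)).div_const 2).congr_deriv (by simp)

lemma hasDerivAt_dilogChar {γ : ℝ → ℂ × ℂ} {γ' : ℂ × ℂ} {t : ℝ}
    (hc : ∀ᶠ s in 𝓝 t, γ s ∈ Cover) (hγ : HasDerivAt γ γ' t) :
    HasDerivAt (fun s => dilogChar (γ s))
      (dilogChar (γ t) * (I / Cpi * ((γ t).2 * γ'.1 - (γ t).1 * γ'.2))) t := by
  have ha : HasDerivAt (fun s => (γ s).1) γ'.1 t := hγ.fst
  have hb : HasDerivAt (fun s => (γ s).2) γ'.2 t := hγ.snd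
  obtain ⟨hz, e⟩ := hasDerivAt_coverProj hc hγ
  have hs := hasDerivAt_coverSign hc hγ
  have hl : ∀ᶠ s in 𝓝 t, LiesOver (γ s) (coverProj (γ s)) := by
    filter_upwards [hc] with s ⟨u, hu, hpt⟩
    have hl : LiesOver (γ s) u := ⟨hu, hpt⟩
    rwa [hl.coverProj_eq]
  have hlt := hl.self_of_nhds
  have n1 := hlt.1.1
  have n2 := hlt.1.one_sub_ne
  have cpi := Cpi_ne_zero
  rcases mem_slitPlane_or (z := coverProj (γ t)) with h | h
  · have hev : (fun s => dilogChar (γ s)) =ᶠ[𝓝 t] fun s =>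
        exp (2 * I / Cpi * rogersOne (coverProj (γ s)) (γ s)) * coverSign (γ s) := by
      filter_upwards [hl, (hz.const_sub 1).continuousAt.preimage_mem_nhds
        (isOpen_slitPlane.mem_nhds h)] with s hs h1
      exact dilogChar_eq_one hs h1
    have hd := (((hasDerivAt_dilog n1 h).comp t hz).add ((ha.mul hb).div_const 2)).add
      (ha.mul ((hz.const_sub 1).clog_real h))
    have hE := ((hd.const_mul (2 * I / Cpi)).cexp.mul hs).congr_of_eventuallyEq hev
    refine hE.congr_deriv ?_
    rw [dilogChar_eq_one hlt h]
    simp only [mul_zero, add_zero, Function.comp, rogersOne, Pi.add_apply, Pi.mul_apply]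
    have e' : -(γ'.1 * coverProj (γ t)) / (1 - coverProj (γ t)) = -γ'.2 := by
      rw [e]
      field_simp
    rw [e']
    field_simp
    ring
  · have hev : (fun s => dilogChar (γ s)) =ᶠ[𝓝 t] fun s =>
        exp (2 * I / Cpi * rogersTwo (coverProj (γ s)) (γ s)) * coverSign (γ s) := by
      filter_upwards [hl, hz.continuousAt.preimage_mem_nhds
        (isOpen_slitPlane.mem_nhds h)] with s hs h1
      exact dilogChar_eq_two hs h1
    have hd := ((((hasDerivAt_dilog n2 (by rwa [sub_sub_cancel])).comp t
      (hz.const_sub 1)).const_sub dilogConst).sub ((ha.mul hb).div_const 2)).add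
      (hb.mul (hz.clog_real h))
    have hE := ((hd.const_mul (2 * I / Cpi)).cexp.mul hs).congr_of_eventuallyEq hev
    refine hE.congr_deriv ?_
    rw [dilogChar_eq_two hlt h]
    simp only [mul_zero, add_zero, Function.comp, rogersTwo, Pi.add_apply, Pi.sub_apply, Pi.mul_apply,
      sub_sub_cancel]
    have e' : -log (coverProj (γ t)) / (1 - coverProj (γ t)) * -(γ'.1 * coverProj (γ t)) =
        log (coverProj (γ t)) * γ'.2 := by
      rw [e]
      field_simp
    rw [e']
    field_simp
    ring

/-- The alternating product of the dilogarithm character over a five term tuple. -/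
def fiveProd (w : Fin 5 → ℂ × ℂ) : ℂ :=
  dilogChar (w 0) * dilogChar (w 2) * dilogChar (w 4) / (dilogChar (w 1) * dilogChar (w 3))

lemma FiveTermLinear.deriv {γ : ℝ → Fin 5 → ℂ × ℂ} {γ' : Fin 5 → ℂ × ℂ} {t : ℝ}
    (hl : ∀ᶠ s in 𝓝 t, FiveTermLinear (γ s)) (hγ : HasDerivAt γ γ' t) : FiveTermLinear γ' := by
  have h1 : ∀ i, HasDerivAt (fun s => (γ s i).1) (γ' i).1 t := fun i => (hasDerivAt_pi.1 hγ i).fst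
  have h2 : ∀ i, HasDerivAt (fun s => (γ s i).2) (γ' i).2 t := fun i => (hasDerivAt_pi.1 hγ i).snd
  exact
    { fst_two := (h1 2).unique (((h1 1).sub (h1 0)).congr_of_eventuallyEq
        (hl.mono fun s h => h.fst_two))
      fst_three := (h1 3).unique (((h1 2).add (h1 4)).congr_of_eventuallyEq
        (hl.mono fun s h => h.fst_three))
      fst_four := (h1 4).unique (((h2 1).sub (h2 0)).congr_of_eventuallyEq
        (hl.mono fun s h => h.fst_four))
      snd_three := (h2 3).unique (((h2 2).sub (h2 1)).congr_of_eventuallyEq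
        (hl.mono fun s h => h.snd_three))
      snd_four := (h2 4).unique (((h2 3).sub (h1 0)).congr_of_eventuallyEq
        (hl.mono fun s h => h.snd_four)) }

lemma mem_Cover_of_mem_FTpre {w : Fin 5 → ℂ × ℂ} (hw : w ∈ FTpre) (i : Fin 5) : w i ∈ Cover := by
  obtain ⟨v, -, h⟩ := hw
  exact (h i).mem_Cover

lemma hasDerivAt_fiveProd {γ : ℝ → Fin 5 → ℂ × ℂ} {γ' : Fin 5 → ℂ × ℂ} {t : ℝ}
    (hc : ∀ᶠ s in 𝓝 t, γ s ∈ FTpre ∧ FiveTermLinear (γ s)) (hγ : HasDerivAt γ γ' t) :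
    HasDerivAt (fun s => fiveProd (γ s)) 0 t := by
  have hd : ∀ i, HasDerivAt (fun s => dilogChar (γ s i)) (dilogChar (γ t i) *
      (I / Cpi * ((γ t i).2 * (γ' i).1 - (γ t i).1 * (γ' i).2))) t := fun i =>
    hasDerivAt_dilogChar (hc.mono fun s h => mem_Cover_of_mem_FTpre h.1 i) (hasDerivAt_pi.1 hγ i)
  have hl' := FiveTermLinear.deriv (hc.mono fun s h => h.2) hγ
  have hl := hc.self_of_nhds.2
  have h0 : ∀ i, dilogChar (γ t i) ≠ 0 := fun i =>
    dilogChar_ne_zero (mem_Cover_of_mem_FTpre hc.self_of_nhds.1 i)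
  refine ((((hd 0).mul (hd 2)).mul (hd 4)).div ((hd 1).mul (hd 3))
    (mul_ne_zero (h0 1) (h0 3))).congr_deriv ?_
  rw [div_eq_zero_iff]
  left
  simp only [Pi.mul_apply, hl.snd_four, hl'.snd_four, hl.snd_three, hl'.snd_three, hl.fst_three,
    hl'.fst_three, hl.fst_four, hl'.fst_four, hl.fst_two, hl'.fst_two]
  ring

lemma fiveProd_segment {x y x' y' : ℂ} (h : Adm x y) (hs : SlitRel x y x' y')
    {w : Fin 5 → ℂ × ℂ} (hw : ∀ i, LiesOver (w i) (ftTuple x y i)) (hl : FiveTermLinear w) :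
    ∃ w' : Fin 5 → ℂ × ℂ, (∀ i, LiesOver (w' i) (ftTuple x' y' i)) ∧ FiveTermLinear w' ∧
      fiveProd w' = fiveProd w := by
  obtain ⟨γ, U, hU, hsub, h0, hγ, h1⟩ := exists_segment_lift h hs hw hl
  refine ⟨γ 1, h1, (hγ 1 (hsub ⟨zero_le_one, le_rfl⟩)).2.1, ?_⟩
  have hd : ∀ t ∈ U, HasDerivAt (fun s => fiveProd (γ s)) 0 t := fun t ht =>
    hasDerivAt_fiveProd ((hU.eventually_mem ht).mono fun s hs =>
      ⟨(hγ s hs).1, (hγ s hs).2.1⟩) (hγ t ht).2.2.hasDerivAt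
  rw [← h0]
  exact constant_of_has_deriv_right_zero
    (fun t ht => (hd t (hsub ht)).continuousAt.continuousWithinAt)
    (fun t ht => (hd t (hsub (Set.Ico_subset_Icc_self ht))).hasDerivWithinAt) 1
    ⟨zero_le_one, le_rfl⟩

lemma fiveProd_covAct {x y : ℂ} (h : Adm x y) {w : Fin 5 → ℂ × ℂ}
    (hw : ∀ i, LiesOver (w i) (ftTuple x y i)) {v : Fin 5 → ℤ × ℤ} (hv : v ∈ Vset) :
    fiveProd (fun i => covAct (v i) (w i)) = fiveProd w := by
  have h1 := h.left.1
  have h2 := h.right.1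
  have h3 := h.right.one_sub_ne
  have h4 := h.left.one_sub_ne
  have h5 := h.sub_ne
  obtain ⟨p₀, p₁, q₀, q₁, q₂, rfl⟩ := hv
  have e2 : ftTuple x y 2 = y / x := rfl
  have e4 : ftTuple x y 4 = (1 - x) / (1 - y) := rfl
  simp only [fiveProd, dilogChar_covAct (hw _), h.one_sub_two, h.one_sub_three, h.one_sub_four]
  simp only [h.ftTuple_three, e2, e4, show ftTuple x y 0 = x from rfl,
    show ftTuple x y 1 = y from rfl, Matrix.cons_val, div_zpow, mul_zpow,
    sub_eq_add_neg, neg_add, neg_neg]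
  simp only [← sub_eq_add_neg]
  generalize 1 - x = X at *
  generalize 1 - y = Y at *
  generalize x - y = d at *
  simp only [zpow_add₀ h1, zpow_add₀ h2, zpow_add₀ h3, zpow_add₀ h4, zpow_add₀ h5,
    zpow_sub₀ h1, zpow_sub₀ h3, zpow_sub₀ h5, zpow_neg]
  field_simp

/-- The dilogarithm character satisfies the five term relation up to a constant. -/
lemma fiveProd_eq_of_mem_FThat {w : Fin 5 → ℂ × ℂ} (hw : w ∈ FThat) :
    fiveProd w = fiveProd basePt := by
  obtain ⟨hw, hl⟩ := mem_FThat_iff.1 hw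
  obtain ⟨x, y, h, ho⟩ := mem_FTpre_iff.1 hw
  obtain ⟨u, v, hs, hs'⟩ := exists_slitRel_slitRel adm_base h
  obtain ⟨w₁, ho₁, hl₁, e₁⟩ := fiveProd_segment adm_base hs liesOver_basePt fiveTermLinear_basePt
  obtain ⟨w₂, ho₂, hl₂, e₂⟩ := fiveProd_segment hs.adm hs' ho₁ hl₁
  obtain ⟨V, hV, rfl⟩ := exists_Vset ho₂ ho hl₂ hl
  rw [fiveProd_covAct h ho₂ hV, e₂, e₁]

/-! ### Homomorphisms out of the extended pre-Bloch group -/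

lemma lift_eq_zero_of_mem_relSub {A : Type*} [AddCommGroup A] {f : CoverT → A}
    (h5 : ∀ w : Fin 5 → CoverT, (fun i => (w i : ℂ × ℂ)) ∈ FThat →
      f (w 0) - f (w 1) + f (w 2) - f (w 3) + f (w 4) = 0)
    (ht : ∀ z, ∀ h : Reg z, ∀ p q p' q' : ℤ,
      f ⟨pt z p q, pt_mem_Cover h p q⟩ + f ⟨pt z p' q', pt_mem_Cover h p' q'⟩ =
        f ⟨pt z p q', pt_mem_Cover h p q'⟩ + f ⟨pt z p' q, pt_mem_Cover h p' q⟩)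
    {a : FreeAbelianGroup CoverT} (ha : a ∈ relSub) : FreeAbelianGroup.lift f a = 0 := by
  have : relSub ≤ (FreeAbelianGroup.lift f).ker := by
    refine (AddSubgroup.closure_le _).2 ?_
    rintro _ (⟨w, hw, hc, rfl⟩ | ⟨z, h, p, q, p', q', rfl⟩)
    · have := h5 (fun i => ⟨w i, hc i⟩) hw
      rw [SetLike.mem_coe, AddMonoidHom.mem_ker, Fin.sum_univ_five]
      simp only [map_add, map_zsmul, FreeAbelianGroup.lift_apply_of]
      rw [← this]
      norm_num
      abel
    · rw [SetLike.mem_coe, AddMonoidHom.mem_ker]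
      simp only [map_add, map_sub, genOf, FreeAbelianGroup.lift_apply_of]
      rw [sub_sub, sub_eq_zero]
      exact ht z h p q p' q'
  exact this ha

lemma cls_of_reg {z : ℂ} (h : Reg z) (p q : ℤ) : cls z p q = QuotientAddGroup.mk (genOf z h p q) :=
  dif_pos h

lemma cls_transfer (z : ℂ) (p q p' q' : ℤ) :
    cls z p q + cls z p' q' = cls z p q' + cls z p' q := by
  by_cases h : Reg z
  · simp only [cls_of_reg h]
    rw [← sub_eq_zero, ← QuotientAddGroup.mk_add, ← QuotientAddGroup.mk_add,
      ← QuotientAddGroup.mk_sub]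
    refine (QuotientAddGroup.eq_zero_iff _).2 (AddSubgroup.subset_closure (Or.inr ?_))
    exact ⟨z, h, p, q, p', q', by abel⟩
  · simp [cls, h]

lemma cls_five_term {z : Fin 5 → ℂ} {P Q : Fin 5 → ℤ} (hz : ∀ i, Reg (z i))
    (h : (fun i => pt (z i) (P i) (Q i)) ∈ FThat) :
    cls (z 0) (P 0) (Q 0) - cls (z 1) (P 1) (Q 1) + cls (z 2) (P 2) (Q 2) -
      cls (z 3) (P 3) (Q 3) + cls (z 4) (P 4) (Q 4) = 0 := by
  simp only [cls_of_reg (hz _)]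
  rw [← QuotientAddGroup.mk_sub, ← QuotientAddGroup.mk_add, ← QuotientAddGroup.mk_sub,
    ← QuotientAddGroup.mk_add]
  refine (QuotientAddGroup.eq_zero_iff _).2 (AddSubgroup.subset_closure (Or.inl ?_))
  refine ⟨_, h, fun i => pt_mem_Cover (hz i) _ _, ?_⟩
  rw [Fin.sum_univ_five]
  norm_num [genOf]
  abel

lemma EPreBloch.hom_ext {A : Type*} [AddCommGroup A] {f g : EPreBloch →+ A}
    (h : ∀ z, Reg z → ∀ p q, f (cls z p q) = g (cls z p q)) : f = g := by
  refine QuotientAddGroup.addMonoidHom_ext _ (FreeAbelianGroup.lift_ext _ _ ?_)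
  rintro ⟨_, z, hz, p, q, rfl⟩
  have := h z hz p q
  rwa [cls_of_reg hz] at this

/-- A homomorphism out of the extended pre-Bloch group. -/
lemma exists_hom_of_coverT {A : Type*} [AddCommGroup A] {f : CoverT → A}
    (h5 : ∀ w : Fin 5 → CoverT, (fun i => (w i : ℂ × ℂ)) ∈ FThat →
      f (w 0) - f (w 1) + f (w 2) - f (w 3) + f (w 4) = 0)
    (ht : ∀ z, ∀ h : Reg z, ∀ p q p' q' : ℤ,
      f ⟨pt z p q, pt_mem_Cover h p q⟩ + f ⟨pt z p' q', pt_mem_Cover h p' q'⟩ =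
        f ⟨pt z p q', pt_mem_Cover h p q'⟩ + f ⟨pt z p' q, pt_mem_Cover h p' q⟩) :
    ∃ F : EPreBloch →+ A, ∀ z, ∀ h : Reg z, ∀ p q,
      F (cls z p q) = f ⟨pt z p q, pt_mem_Cover h p q⟩ := by
  refine ⟨QuotientAddGroup.lift relSub (FreeAbelianGroup.lift f) fun a ha =>
    lift_eq_zero_of_mem_relSub h5 ht ha, fun z h p q => ?_⟩
  rw [cls_of_reg h]
  exact FreeAbelianGroup.lift_apply_of _ _

/-- The exponentiated regulator. -/
lemma exists_regulator : ∃ T : EPreBloch →+ Additive ℂˣ, ∀ z, ∀ h : Reg z,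
    T (cls z 0 1) - T (cls z 0 0) = -Additive.ofMul (Units.mk0 z h.1) := by
  have hc : fiveProd basePt ≠ 0 := by
    have h : ∀ i, dilogChar (basePt i) ≠ 0 := fun i =>
      dilogChar_ne_zero (liesOver_basePt i).mem_Cover
    exact div_ne_zero (mul_ne_zero (mul_ne_zero (h 0) (h 2)) (h 4)) (mul_ne_zero (h 1) (h 3))
  let f : CoverT → Additive ℂˣ := fun w => Additive.ofMul (Units.mk0 (dilogChar w / fiveProd basePt)
    (div_ne_zero (dilogChar_ne_zero w.2) hc))
  obtain ⟨T, hT⟩ := exists_hom_of_coverT (f := f) (fun w hw => by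
    have e := fiveProd_eq_of_mem_FThat hw
    rw [fiveProd] at e
    have h : ∀ i, dilogChar (w i) ≠ 0 := fun i => dilogChar_ne_zero (w i).2
    apply Additive.toMul.injective
    apply Units.ext
    simp only [f, toMul_add, toMul_sub, toMul_ofMul, Units.val_mul, Units.val_div_eq_div_val,
      Units.val_mk0, toMul_zero, Units.val_one]
    rw [← e]
    have := h 0
    have := h 1
    have := h 2
    have := h 3
    have := h 4
    field_simp) (fun z h p q p' q' => by
    apply Additive.toMul.injective
    apply Units.ext
    simp only [f, toMul_add, toMul_ofMul, Units.val_mul, Units.val_mk0]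
    rw [dilogChar_pt h p q, dilogChar_pt h p' q', dilogChar_pt h p q', dilogChar_pt h p' q]
    ring)
  refine ⟨T, fun z h => ?_⟩
  rw [hT z h, hT z h]
  apply Additive.toMul.injective
  apply Units.ext
  have h0 := dilogChar_ne_zero (pt_mem_Cover h 0 0)
  have h1 := h.1
  simp only [f, toMul_sub, toMul_ofMul, toMul_neg, Units.val_div_eq_div_val, Units.val_inv_eq_inv_val,
    Units.val_mk0, dilogChar_pt h 0 1, neg_zero, zpow_zero, mul_one, zpow_neg_one]
  field_simp

/-! ### The homomorphism `χ` -/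

lemma exists_cls_five_term {x y : ℂ} (h : Adm x y) : ∃ P Q : Fin 5 → ℤ, ∀ p₀ p₁ q₀ q₁ q₂ : ℤ,
    cls x (P 0 + p₀) (Q 0 + q₀) - cls y (P 1 + p₁) (Q 1 + q₁) +
      cls (ftTuple x y 2) (P 2 + (p₁ - p₀)) (Q 2 + q₂) -
      cls (ftTuple x y 3) (P 3 + (p₁ - p₀ + q₁ - q₀)) (Q 3 + (q₂ - q₁)) +
      cls (ftTuple x y 4) (P 4 + (q₁ - q₀)) (Q 4 + (q₂ - q₁ - p₀)) = 0 := by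
  obtain ⟨P, Q, hPQ⟩ := exists_five_term_lift h
  refine ⟨P, Q, fun p₀ p₁ q₀ q₁ q₂ => ?_⟩
  have := cls_five_term (z := ftTuple x y) h.reg_ftTuple (hPQ _ ⟨p₀, p₁, q₀, q₁, q₂, rfl⟩)
  simp only [Matrix.cons_val] at this
  exact this

/-- The difference `[z, 0, q + 1] - [z, 0, q]`. -/
def stepQ (z : ℂ) (q : ℤ) : EPreBloch := cls z 0 (q + 1) - cls z 0 q

lemma cls_succ_right (z : ℂ) (p q : ℤ) : cls z p (q + 1) = cls z p q + stepQ z q := by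
  have := cls_transfer z p (q + 1) 0 q
  rw [stepQ, ← add_sub_assoc, eq_sub_iff_add_eq, this]

/-- The parameters of a five term relation with prescribed third and fifth term. -/
lemma exists_adm {s t : ℂ} (hs : Reg s) (ht : Reg t) (hst : s * t ≠ 1) : ∃ x y, Adm x y ∧
    ftTuple x y 2 = s ∧ ftTuple x y 3 = s * t ∧ ftTuple x y 4 = t := by
  have h1 : s * t - 1 ≠ 0 := sub_ne_zero_of_ne hst
  have h2 : t - 1 ≠ 0 := sub_ne_zero_of_ne ht.2
  have h3 : s - 1 ≠ 0 := sub_ne_zero_of_ne hs.2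
  have hs0 := hs.1
  have ht0 := ht.1
  have e1 : 1 - (t - 1) / (s * t - 1) = t * (s - 1) / (s * t - 1) := by
    rw [eq_div_iff h1, sub_mul, div_mul_cancel₀ _ h1]
    ring
  have e2 : 1 - s * ((t - 1) / (s * t - 1)) = (s - 1) / (s * t - 1) := by
    rw [eq_div_iff h1, sub_mul, mul_assoc, div_mul_cancel₀ _ h1]
    ring
  have key : ∀ z : ℂ, z ≠ 0 → 1 - z ≠ 0 → Reg z := fun z a b =>
    ⟨a, fun e => b (by rw [e, sub_self])⟩
  have hx : (t - 1) / (s * t - 1) ≠ 0 := div_ne_zero h2 h1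
  have h : Adm ((t - 1) / (s * t - 1)) (s * ((t - 1) / (s * t - 1))) :=
    { left := key _ hx (e1 ▸ div_ne_zero (mul_ne_zero ht0 h3) h1)
      right := key _ (mul_ne_zero hs0 hx) (e2 ▸ div_ne_zero h3 h1)
      ne := fun e => hs.2 (mul_right_cancel₀ hx (by rw [← e, one_mul])) }
  refine ⟨_, _, h, ?_, ?_, ?_⟩
  · exact mul_div_cancel_right₀ s hx
  · rw [h.ftTuple_three, e1, e2, div_eq_iff (mul_ne_zero hx (div_ne_zero h3 h1))]
    ring
  · change (1 - _) / (1 - _) = t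
    rw [e1, e2, div_eq_iff (div_ne_zero h3 h1)]
    ring

lemma stepQ_add {s t : ℂ} (hs : Reg s) (ht : Reg t) (hst : s * t ≠ 1) (m n k : ℤ) :
    stepQ s m + stepQ t k = stepQ (s * t) n := by
  obtain ⟨x, y, h, e2, e3, e4⟩ := exists_adm hs ht hst
  obtain ⟨P, Q, hPQ⟩ := exists_cls_five_term h
  rw [e2, e3, e4] at hPQ
  have h1 := hPQ (n - Q 3 - (k - Q 4)) 0 0 (m - Q 2 - (n - Q 3)) (m - Q 2)
  have h2 := hPQ (n - Q 3 - (k - Q 4)) 0 0 (m - Q 2 - (n - Q 3)) (m - Q 2 + 1)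
  rw [show Q 2 + (m - Q 2 + 1) = m + 1 by ring,
    show Q 3 + (m - Q 2 + 1 - (m - Q 2 - (n - Q 3))) = n + 1 by ring,
    show Q 4 + (m - Q 2 + 1 - (m - Q 2 - (n - Q 3)) - (n - Q 3 - (k - Q 4))) = k + 1 by ring,
    cls_succ_right, cls_succ_right, cls_succ_right] at h2
  rw [show Q 2 + (m - Q 2) = m by ring,
    show Q 3 + (m - Q 2 - (m - Q 2 - (n - Q 3))) = n by ring,
    show Q 4 + (m - Q 2 - (m - Q 2 - (n - Q 3)) - (n - Q 3 - (k - Q 4))) = k by ring] at h1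
  rw [← sub_eq_zero, ← sub_eq_zero.2 (h2.trans h1.symm)]
  abel

lemma exists_reg_mul_ne_one (s : ℂ) : ∃ t, Reg t ∧ s * t ≠ 1 := by
  by_cases h : s = 1 / 2
  · exact ⟨3, ⟨by norm_num, by norm_num⟩, by rw [h]; norm_num⟩
  · exact ⟨2, ⟨by norm_num, by norm_num⟩, fun e => h (by linear_combination e / 2)⟩

/-- The difference `[z, 0, 1] - [z, 0, 0]`, which is zero for `z = 1`. -/
def chiFun (z : ℂ) : EPreBloch := cls z 0 1 - cls z 0 0

lemma stepQ_eq (z : ℂ) (m : ℤ) : stepQ z m = chiFun z := by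
  by_cases hz : Reg z
  · obtain ⟨t, ht, hzt⟩ := exists_reg_mul_ne_one z
    exact add_right_cancel ((stepQ_add hz ht hzt m 0 0).trans (stepQ_add hz ht hzt 0 0 0).symm)
  · simp [stepQ, chiFun, cls, hz]

lemma chiFun_one : chiFun 1 = 0 := by
  simp [chiFun, cls, Reg]

lemma chiFun_mul {s t : ℂ} (hs : s ≠ 0) (ht : t ≠ 0) :
    chiFun (s * t) = chiFun s + chiFun t := by
  have gen : ∀ s t : ℂ, Reg s → Reg t → s * t ≠ 1 → chiFun (s * t) = chiFun s + chiFun t :=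
    fun s t hs ht h => (stepQ_add hs ht h 0 0 0).symm
  by_cases hs1 : s = 1
  · rw [hs1, one_mul, chiFun_one, zero_add]
  by_cases ht1 : t = 1
  · rw [ht1, mul_one, chiFun_one, add_zero]
  by_cases hst : s * t = 1
  · obtain ⟨u, hu, hsu⟩ := exists_reg_mul_ne_one s
    have e : t * (s * u) = u := by linear_combination u * hst
    have h1 := gen t (s * u) ⟨ht, ht1⟩ ⟨mul_ne_zero hs hu.1, hsu⟩ (by rw [e]; exact hu.2)
    rw [e, gen s u ⟨hs, hs1⟩ hu hsu] at h1
    rw [hst, chiFun_one]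
    rw [← add_assoc, add_comm (chiFun t)] at h1
    exact add_right_cancel ((zero_add (chiFun u)).trans h1)
  · exact gen s t ⟨hs, hs1⟩ ⟨ht, ht1⟩ hst

/-- The homomorphism `χ`. -/
def chiHom : Additive ℂˣ →+ EPreBloch :=
  AddMonoidHom.mk' (fun u => chiFun (u.toMul : ℂˣ)) fun u v => by
    rw [toMul_add, Units.val_mul, chiFun_mul (Units.ne_zero _) (Units.ne_zero _)]

lemma chiHom_apply (z : ℂ) (hz : z ≠ 0) : chiHom (Additive.ofMul (Units.mk0 z hz)) = chiFun z := rfl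

lemma eq_add_zsmul_of_step {A : Type*} [AddCommGroup A] {f : ℤ → A} {c : A}
    (h : ∀ n, f (n + 1) = f n + c) (n : ℤ) : f n = f 0 + n • c := by
  induction n with
  | zero => rw [zero_smul, add_zero]
  | succ n ih => rw [h, ih, add_smul, one_smul, add_assoc]
  | pred n ih =>
    have := h (-(n : ℤ) - 1)
    rw [sub_add_cancel, ih] at this
    rw [sub_smul, one_smul, ← add_sub_assoc, this, add_sub_cancel_right]

lemma cls_eq_add_zsmul (z : ℂ) (p q : ℤ) : cls z p q = cls z p 0 + q • chiFun z :=
  eq_add_zsmul_of_step (f := cls z p) (fun n => by rw [cls_succ_right, stepQ_eq]) q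

/-! ### The projection to the classical pre-Bloch group -/

lemma map_cls_eq_of_chiFun_eq_zero {A : Type*} [AddCommGroup A] {F : EPreBloch →+ A}
    (hF : ∀ z, F (chiFun z) = 0) {z : ℂ} (hz : Reg z) (p q : ℤ) :
    F (cls z p q) = F (cls z 0 0) := by
  have hq : ∀ z p q, F (cls z p q) = F (cls z p 0) := fun z p q => by
    rw [cls_eq_add_zsmul, map_add, map_zsmul, hF, zsmul_zero, add_zero]
  have key : ∀ x y, Adm x y → ∃ P : Fin 5 → ℤ, ∀ p₀ p₁ : ℤ,
      F (cls x (P 0 + p₀) 0) - F (cls y (P 1 + p₁) 0) +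
        F (cls (ftTuple x y 2) (P 2 + (p₁ - p₀)) 0) -
        F (cls (ftTuple x y 3) (P 3 + (p₁ - p₀)) 0) + F (cls (ftTuple x y 4) (P 4) 0) = 0 := by
    intro x y h
    obtain ⟨P, Q, hPQ⟩ := exists_cls_five_term h
    refine ⟨P, fun p₀ p₁ => ?_⟩
    have := congrArg F (hPQ p₀ p₁ 0 0 0)
    simp only [map_add, map_sub, map_zero, sub_zero, add_zero] at this
    rw [hq x, hq y, hq (ftTuple x y 2), hq (ftTuple x y 3), hq (ftTuple x y 4)] at this
    exact this
  have step : ∀ x y, Adm x y → ∀ a b : ℤ, F (cls x (a + 1) 0) - F (cls x a 0) =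
      F (cls y (b + 1) 0) - F (cls y b 0) := by
    intro x y h a b
    obtain ⟨P, hP⟩ := key x y h
    have h1 := hP (a - P 0) (b - P 1)
    have h2 := hP (a + 1 - P 0) (b + 1 - P 1)
    rw [show b + 1 - P 1 - (a + 1 - P 0) = b - P 1 - (a - P 0) by ring] at h2
    simp only [add_sub_cancel] at h1 h2
    rw [← sub_eq_zero, ← sub_eq_zero.2 (h2.trans h1.symm)]
    abel
  have hu : ∀ z, ∃ u, Reg u ∧ u ≠ z := fun z => by
    by_cases h : z = 2
    · exact ⟨3, ⟨by norm_num, by norm_num⟩, by rw [h]; norm_num⟩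
    · exact ⟨2, ⟨by norm_num, by norm_num⟩, Ne.symm h⟩
  have step' : ∀ x y, Reg x → Reg y → ∀ a b : ℤ, F (cls x (a + 1) 0) - F (cls x a 0) =
      F (cls y (b + 1) 0) - F (cls y b 0) := by
    intro x y hx hy a b
    by_cases h : x = y
    · obtain ⟨u, hu, hux⟩ := hu x
      exact (step x u ⟨hx, hu, hux.symm⟩ a 0).trans (step u y ⟨hu, hy, h ▸ hux⟩ 0 b)
    · exact step x y ⟨hx, hy, h⟩ a b
  have const : ∀ y, Reg y → ∀ b : ℤ, F (cls y (b + 1) 0) = F (cls y b 0) + 0 := by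
    intro y hy b
    obtain ⟨x, hx, hxy⟩ := hu y
    have hA : Adm x y := ⟨hx, hy, hxy⟩
    obtain ⟨P, hP⟩ := key x y hA
    have h1 := hP 0 (b - P 1)
    have h2 := hP 0 (b + 1 - P 1)
    rw [show P 2 + (b + 1 - P 1 - 0) = P 2 + (b - P 1 - 0) + 1 by ring,
      show P 3 + (b + 1 - P 1 - 0) = P 3 + (b - P 1 - 0) + 1 by ring] at h2
    simp only [add_sub_cancel] at h1 h2
    have h3 := step' _ _ (hA.reg_ftTuple 2) (hA.reg_ftTuple 3) (P 2 + (b - P 1 - 0))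
      (P 3 + (b - P 1 - 0))
    rw [← sub_eq_zero] at h3
    rw [add_zero, ← sub_eq_zero, ← h3, ← sub_eq_zero, ← sub_eq_zero.2 (h1.trans h2.symm)]
    abel
  rw [hq, eq_add_zsmul_of_step (f := fun n => F (cls z n 0)) (const z hz) p, zsmul_zero, add_zero]

lemma pbCls_of_reg {z : ℂ} (h : Reg z) : pbCls z = QuotientAddGroup.mk (pbGen z h) := dif_pos h

lemma pbCls_five_term {x y : ℂ} (h : Adm x y) :
    pbCls (ftTuple x y 0) - pbCls (ftTuple x y 1) + pbCls (ftTuple x y 2) -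
      pbCls (ftTuple x y 3) + pbCls (ftTuple x y 4) = 0 := by
  simp only [pbCls_of_reg (h.reg_ftTuple _)]
  rw [← QuotientAddGroup.mk_sub, ← QuotientAddGroup.mk_add, ← QuotientAddGroup.mk_sub,
    ← QuotientAddGroup.mk_add]
  refine (QuotientAddGroup.eq_zero_iff _).2 (AddSubgroup.subset_closure ?_)
  exact ⟨x, y, h.left, h.right, h.ne, h.reg_ftTuple 2, h.reg_ftTuple 3, h.reg_ftTuple 4, rfl⟩

lemma lift_eq_zero_of_mem_pbSub {A : Type*} [AddCommGroup A] {f : ℂ → A}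
    (h5 : ∀ x y, Adm x y → f (ftTuple x y 0) - f (ftTuple x y 1) + f (ftTuple x y 2) -
      f (ftTuple x y 3) + f (ftTuple x y 4) = 0)
    {a : FreeAbelianGroup RegT} (ha : a ∈ pbSub) :
    FreeAbelianGroup.lift (fun z : RegT => f z) a = 0 := by
  have : pbSub ≤ (FreeAbelianGroup.lift fun z : RegT => f z).ker := by
    refine (AddSubgroup.closure_le _).2 ?_
    rintro _ ⟨x, y, hx, hy, hxy, h2, h3, h4, rfl⟩
    rw [SetLike.mem_coe, AddMonoidHom.mem_ker]
    simp only [map_add, map_sub, pbGen, FreeAbelianGroup.lift_apply_of]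
    exact h5 x y ⟨hx, hy, hxy⟩
  exact this ha

lemma exists_hom_of_pb {A : Type*} [AddCommGroup A] {f : ℂ → A}
    (h5 : ∀ x y, Adm x y → f (ftTuple x y 0) - f (ftTuple x y 1) + f (ftTuple x y 2) -
      f (ftTuple x y 3) + f (ftTuple x y 4) = 0) :
    ∃ F : PreBloch →+ A, ∀ z, Reg z → F (pbCls z) = f z := by
  refine ⟨QuotientAddGroup.lift pbSub (FreeAbelianGroup.lift fun z : RegT => f z) fun a ha =>
    lift_eq_zero_of_mem_pbSub h5 ha, fun z h => ?_⟩
  rw [pbCls_of_reg h]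
  exact FreeAbelianGroup.lift_apply_of _ _

lemma PreBloch.hom_ext {A : Type*} [AddCommGroup A] {f g : PreBloch →+ A}
    (h : ∀ z, Reg z → f (pbCls z) = g (pbCls z)) : f = g := by
  refine QuotientAddGroup.addMonoidHom_ext _ (FreeAbelianGroup.lift_ext _ _ ?_)
  rintro ⟨z, hz⟩
  have := h z hz
  rwa [pbCls_of_reg hz] at this

lemma exists_pbHom : ∃ Ψ : EPreBloch →+ PreBloch, ∀ z, Reg z → ∀ p q, Ψ (cls z p q) = pbCls z := by
  obtain ⟨F, hF⟩ := exists_hom_of_coverT (f := fun w => pbCls (coverProj w)) (fun w hw => by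
    obtain ⟨x, y, h, hl⟩ := mem_FTpre_iff.1 (mem_FThat_iff.1 hw).1
    simp only [(hl _).coverProj_eq]
    exact pbCls_five_term h) (fun z h p q p' q' => by
    simp only [(liesOver_pt h _ _).coverProj_eq])
  exact ⟨F, fun z h p q => by rw [hF z h, (liesOver_pt h p q).coverProj_eq]⟩

/-- The natural homomorphism to the classical pre-Bloch group, `[z, p, q] ↦ [z]`. -/
def pbHom : EPreBloch →+ PreBloch := exists_pbHom.choose

lemma pbHom_cls {z : ℂ} (h : Reg z) (p q : ℤ) : pbHom (cls z p q) = pbCls z :=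
  exists_pbHom.choose_spec z h p q

lemma pbHom_chiFun (z : ℂ) : pbHom (chiFun z) = 0 := by
  by_cases h : Reg z
  · rw [chiFun, map_sub, pbHom_cls h, pbHom_cls h, sub_self]
  · simp [chiFun, cls, h]

lemma pbHom_surjective : Function.Surjective pbHom := by
  have h : QuotientAddGroup.mk' pbHom.range = 0 := PreBloch.hom_ext fun z hz =>
    (QuotientAddGroup.eq_zero_iff _).2 ⟨cls z 0 0, pbHom_cls hz 0 0⟩
  intro b
  exact (QuotientAddGroup.eq_zero_iff b).1 (DFunLike.congr_fun h b)

lemma pbHom_eq_zero_iff {a : EPreBloch} : pbHom a = 0 ↔ ∃ u, chiHom u = a := by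
  constructor
  · intro ha
    let mk := QuotientAddGroup.mk' chiHom.range
    have hmk : ∀ z, mk (chiFun z) = 0 := fun z => by
      by_cases hz : Reg z
      · exact (QuotientAddGroup.eq_zero_iff _).2 ⟨_, chiHom_apply z hz.1⟩
      · simp [chiFun, cls, hz]
    obtain ⟨S, hS⟩ := exists_hom_of_pb (f := fun z => mk (cls z 0 0)) fun x y h => by
      obtain ⟨P, Q, hPQ⟩ := exists_cls_five_term h
      have := congrArg mk (hPQ 0 0 0 0 0)
      simp only [map_add, map_sub, map_zero] at this
      rw [map_cls_eq_of_chiFun_eq_zero hmk h.left, map_cls_eq_of_chiFun_eq_zero hmk h.right,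
        map_cls_eq_of_chiFun_eq_zero hmk (h.reg_ftTuple 2),
        map_cls_eq_of_chiFun_eq_zero hmk (h.reg_ftTuple 3),
        map_cls_eq_of_chiFun_eq_zero hmk (h.reg_ftTuple 4)] at this
      exact this
    have h : S.comp pbHom = mk := EPreBloch.hom_ext fun z hz p q => by
      rw [AddMonoidHom.comp_apply, pbHom_cls hz, hS z hz, map_cls_eq_of_chiFun_eq_zero hmk hz p q]
    refine (QuotientAddGroup.eq_zero_iff (N := chiHom.range) a).1 ?_
    change mk a = 0
    rw [← h, AddMonoidHom.comp_apply, ha, map_zero]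
  · rintro ⟨u, rfl⟩
    exact pbHom_chiFun _

/-! ### The homomorphisms `ν` -/

lemma FiveTermLinear.sum_wedge_eq_zero {w : Fin 5 → ℂ × ℂ} (h : FiveTermLinear w) :
    wedge (w 0).1 (w 0).2 - wedge (w 1).1 (w 1).2 + wedge (w 2).1 (w 2).2 -
      wedge (w 3).1 (w 3).2 + wedge (w 4).1 (w 4).2 = 0 := by
  simp only [wedge_eq_wedgeHom]
  rw [h.snd_four, h.snd_three, h.fst_three, h.fst_four, h.fst_two]
  simp only [map_add, map_sub, AddMonoidHom.add_apply, AddMonoidHom.sub_apply]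
  rw [wedgeHom_swap (w 1).2 (w 0).1, wedgeHom_swap (w 0).2 (w 0).1]
  abel

lemma wedge_transfer (z : ℂ) (p q p' q' : ℤ) :
    wedge (pt z p q).1 (pt z p q).2 + wedge (pt z p' q').1 (pt z p' q').2 =
      wedge (pt z p q').1 (pt z p q').2 + wedge (pt z p' q).1 (pt z p' q).2 := by
  simp only [wedge_eq_wedgeHom, pt, ← zsmul_eq_mul, map_add, AddMonoidHom.add_apply, map_zsmul,
    AddMonoidHom.zsmul_apply, wedgeHom_self, smul_zero]
  abel

lemma nuHom_cls {z : ℂ} (h : Reg z) (p q : ℤ) :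
    nuHom (cls z p q) = wedge (pt z p q).1 (pt z p q).2 := by
  have h0 : ∀ a ∈ relSub, nuFree a = 0 := fun a ha =>
    lift_eq_zero_of_mem_relSub (fun w hw => (mem_FThat_iff.1 hw).2.sum_wedge_eq_zero)
      (fun z _ => wedge_transfer z) ha
  rw [nuHom, dif_pos h0, cls_of_reg h]
  exact FreeAbelianGroup.lift_apply_of _ _

lemma nuHom_chiFun {z : ℂ} (hz : z ≠ 0) : nuHom (chiFun z) = wedge (log z) (Cpi * I) := by
  simp only [wedge_eq_wedgeHom]
  by_cases h : z = 1
  · rw [h, chiFun_one, log_one, map_zero, map_zero, AddMonoidHom.zero_apply]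
  · have hr : Reg z := ⟨hz, h⟩
    rw [chiFun, map_sub, nuHom_cls hr, nuHom_cls hr]
    simp [wedge_eq_wedgeHom, pt]

lemma wedgeHom_rat_mul (r : ℚ) (c : ℂ) : wedgeHom ℂ (r * c) c = 0 := by
  have hd : (r.den : ℂ) ≠ 0 := Nat.cast_ne_zero.2 r.den_nz
  have h1 : (r * c : ℂ) = r.num • (c / r.den) := by
    rw [zsmul_eq_mul, Rat.cast_def]
    ring
  have h2 : c = (r.den : ℤ) • (c / r.den) := by
    rw [zsmul_eq_mul, Int.cast_natCast, mul_div_cancel₀ _ hd]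
  rw [h1]
  nth_rewrite 2 [h2]
  rw [map_zsmul, map_zsmul, AddMonoidHom.zsmul_apply, wedgeHom_self, smul_zero, smul_zero]

lemma wedgeHom_int_mul (n : ℤ) (c : ℂ) : wedgeHom ℂ (n * c) c = 0 := by
  exact_mod_cast wedgeHom_rat_mul n c

lemma chiHom_mem_EBloch_iff {ζ : ℂˣ} : chiHom (Additive.ofMul ζ) ∈ EBloch ↔ ζ ∈ muStar := by
  have e : chiHom (Additive.ofMul ζ) ∈ EBloch ↔ wedge (log ζ) (Cpi * I) = 0 := by
    rw [← nuHom_chiFun ζ.ne_zero]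
    exact Iff.rfl
  rw [e]
  constructor
  · intro h
    obtain ⟨r, hr⟩ := exists_rat_of_wedge_eq_zero Cpi_mul_I_ne_zero h
    refine ⟨2 * r.den, Nat.mul_pos two_pos r.den_pos, Units.ext ?_⟩
    have hd : (r.den : ℂ) ≠ 0 := Nat.cast_ne_zero.2 r.den_nz
    rw [Units.val_pow_eq_pow_val, Units.val_one, ← exp_log ζ.ne_zero, ← exp_nat_mul, hr,
      ← exp_int_mul_two_Cpi r.num, Rat.cast_def]
    congr 1
    push_cast
    field_simp
  · rintro ⟨n, hn, h⟩
    have hn0 : (n : ℂ) ≠ 0 := Nat.cast_ne_zero.2 hn.ne'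
    have h1 : exp (n * log ζ) = 1 := by
      rw [exp_nat_mul, exp_log ζ.ne_zero, ← Units.val_pow_eq_pow_val, h, Units.val_one]
    obtain ⟨k, hk⟩ := exp_eq_one_iff.1 h1
    have h2 : log (ζ : ℂ) = ((2 * k / n : ℚ) : ℂ) * (Cpi * I) := by
      rw [← mul_right_inj' hn0, hk, Cpi]
      push_cast
      field_simp
    rw [h2]
    exact wedgeHom_rat_mul _ _

lemma chiHom_injective : Function.Injective chiHom := by
  obtain ⟨T, hT⟩ := exists_regulator
  refine (injective_iff_map_eq_zero chiHom).2 fun u hu => ?_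
  by_cases h : ((u.toMul : ℂˣ) : ℂ) = 1
  · exact Additive.toMul.injective (Units.ext h)
  · have h1 := hT _ ⟨(u.toMul).ne_zero, h⟩
    rw [← map_sub] at h1
    have h2 : cls (u.toMul : ℂˣ) 0 1 - cls (u.toMul : ℂˣ) 0 0 = 0 := hu
    rw [h2, map_zero, Units.mk0_val] at h1
    exact neg_eq_zero.1 h1.symm

/-- The exponential map as a homomorphism to `ℂ*`. -/
def expHom : ℂ →+ Additive ℂˣ :=
  AddMonoidHom.mk' (fun a => Additive.ofMul (Units.mk0 (exp a) (exp_ne_zero a))) fun a b => by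
    apply Additive.toMul.injective
    apply Units.ext
    exact exp_add a b

lemma exists_wedgeExp : ∃ F : L2C →+ L2CU, ∀ a b,
    F (wedge a b) = wedgeHom (Additive ℂˣ) (expHom a) (expHom b) :=
  exists_hom_exteriorPower (((wedgeHom (Additive ℂˣ)).compl₂ expHom).comp expHom)
    fun _ => wedgeHom_self _

/-- The homomorphism `a ∧ b ↦ exp a ∧ exp b`. -/
def wedgeExp : L2C →+ L2CU := exists_wedgeExp.choose

lemma wedgeExp_wedge (a b : ℂ) :
    wedgeExp (wedge a b) = wedgeHom (Additive ℂˣ) (expHom a) (expHom b) :=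
  exists_wedgeExp.choose_spec a b

lemma two_nsmul_wedgeHom {M : Type*} [AddCommGroup M] {a a' b b' : M}
    (ha : (2 : ℕ) • a = (2 : ℕ) • a') (hb : (2 : ℕ) • b = (2 : ℕ) • b') :
    (2 : ℕ) • wedgeHom M a b = (2 : ℕ) • wedgeHom M a' b' := by
  rw [← AddMonoidHom.nsmul_apply, ← map_nsmul, ha, map_nsmul, AddMonoidHom.nsmul_apply,
    ← map_nsmul, hb, map_nsmul]

lemma two_nsmul_wedgeExp {w : ℂ × ℂ} {z : ℂ} (h : LiesOver w z) (hz : Reg z) :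
    (2 : ℕ) • wedgeExp (wedge w.1 w.2) =
      -((2 : ℕ) • wedgeU (Units.mk0 z hz.1) (Units.mk0 (1 - z) hz.one_sub_ne)) := by
  obtain ⟨-, h1, h2⟩ := liesOver_iff.1 h
  have e1 : (2 : ℕ) • expHom w.1 = (2 : ℕ) • Additive.ofMul (Units.mk0 z hz.1) := by
    rw [← map_nsmul]
    apply Additive.toMul.injective
    apply Units.ext
    change exp ((2 : ℕ) • w.1) = z ^ 2
    rw [← h1, nsmul_eq_mul, Nat.cast_ofNat]
  have e2 : (2 : ℕ) • expHom w.2 =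
      (2 : ℕ) • -Additive.ofMul (Units.mk0 (1 - z) hz.one_sub_ne) := by
    rw [← map_nsmul, neg_nsmul]
    apply eq_neg_of_add_eq_zero_left
    apply Additive.toMul.injective
    apply Units.ext
    change exp ((2 : ℕ) • w.2) * (1 - z) ^ 2 = 1
    rw [nsmul_eq_mul, Nat.cast_ofNat, h2]
  rw [wedgeExp_wedge, two_nsmul_wedgeHom e1 e2, map_neg, smul_neg, wedgeU_eq_wedgeHom]

lemma nuPB_pbCls {z : ℂ} (h : Reg z) :
    nuPB (pbCls z) = 2 • wedgeU (Units.mk0 z h.1) (Units.mk0 (1 - z) h.one_sub_ne) := by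
  let f : ℂ → L2CU := fun z => -((2 : ℕ) • wedgeExp (wedge (pt z 0 0).1 (pt z 0 0).2))
  have hf : ∀ w z, LiesOver w z → f z = -((2 : ℕ) • wedgeExp (wedge w.1 w.2)) := fun w z hw => by
    rw [two_nsmul_wedgeExp hw hw.1]
    exact congrArg Neg.neg (two_nsmul_wedgeExp (liesOver_pt hw.1 0 0) hw.1)
  have e : nuPBFree = FreeAbelianGroup.lift fun z : RegT => f z := by
    refine FreeAbelianGroup.lift_ext _ _ fun z => ?_
    rw [nuPBFree, FreeAbelianGroup.lift_apply_of, FreeAbelianGroup.lift_apply_of,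
      hf _ _ (liesOver_pt z.2 0 0), two_nsmul_wedgeExp (liesOver_pt z.2 0 0) z.2, neg_neg]
  have h0 : ∀ a ∈ pbSub, nuPBFree a = 0 := fun a ha => by
    rw [e]
    refine lift_eq_zero_of_mem_pbSub (fun x y hxy => ?_) ha
    obtain ⟨P, Q, hPQ⟩ := exists_five_term_lift hxy
    have h5 := (mem_FThat_iff.1 (hPQ _ ⟨0, 0, 0, 0, 0, rfl⟩)).2.sum_wedge_eq_zero
    have h6 := congrArg (-((2 : ℕ) • wedgeExp)) h5
    simp only [map_add, map_sub, map_zero] at h6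
    rw [hf _ _ (liesOver_pt (hxy.reg_ftTuple 0) _ _), hf _ _ (liesOver_pt (hxy.reg_ftTuple 1) _ _),
      hf _ _ (liesOver_pt (hxy.reg_ftTuple 2) _ _), hf _ _ (liesOver_pt (hxy.reg_ftTuple 3) _ _),
      hf _ _ (liesOver_pt (hxy.reg_ftTuple 4) _ _)]
    exact h6
  rw [nuPB, dif_pos h0, pbCls_of_reg h]
  exact FreeAbelianGroup.lift_apply_of _ _

lemma nuPB_pbHom (a : EPreBloch) : nuPB (pbHom a) = -((2 : ℕ) • wedgeExp (nuHom a)) := by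
  have : nuPB.comp pbHom = -((2 : ℕ) • wedgeExp.comp nuHom) := EPreBloch.hom_ext fun z h p q => by
    simp only [AddMonoidHom.comp_apply, AddMonoidHom.neg_apply, AddMonoidHom.nsmul_apply]
    rw [pbHom_cls h, nuPB_pbCls h, nuHom_cls h, two_nsmul_wedgeExp (liesOver_pt h p q) h, neg_neg]
  exact DFunLike.congr_fun this a

/-- The homomorphism `u ↦ u ∧ πi`. -/
def wedgePi : ℂ →+ L2C := (wedgeHom ℂ).flip (Cpi * I)

lemma wedgePi_mem_left (n : ℤ) (b : ℂ) : wedgeHom ℂ (n * (Cpi * I)) b ∈ wedgePi.range := by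
  refine ⟨-(n * b), ?_⟩
  rw [wedgeHom_swap, ← zsmul_eq_mul, ← zsmul_eq_mul, map_zsmul, map_neg, map_zsmul]
  rfl

lemma exists_log_mul (a b : ℂˣ) : ∃ n : ℤ,
    log ((a * b : ℂˣ) : ℂ) = log a + log b + 2 * (n * (Cpi * I)) := by
  have : exp (log ((a * b : ℂˣ) : ℂ)) = exp (log a + log b) := by
    rw [exp_log (Units.ne_zero _), exp_add, exp_log a.ne_zero, exp_log b.ne_zero, Units.val_mul]
  obtain ⟨n, hn⟩ := exp_eq_exp_iff_exists_int.1 this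
  exact ⟨n, by rw [hn, Cpi]; ring⟩

lemma exists_log_exp (a : ℂ) : ∃ n : ℤ, log (exp a) = a + 2 * (n * (Cpi * I)) := by
  obtain ⟨n, hn⟩ := exp_eq_exp_iff_exists_int.1 (exp_log (exp_ne_zero a))
  exact ⟨n, by rw [hn, Cpi]; ring⟩

lemma wedgePi_mem_right (n : ℤ) (a : ℂ) : wedgeHom ℂ a (2 * (n * (Cpi * I))) ∈ wedgePi.range := by
  rw [wedgeHom_swap, ← mul_assoc]
  exact neg_mem (by exact_mod_cast wedgePi_mem_left (2 * n) a)

/-- The map `exp a ∧ exp b ↦ ½ a ∧ b`, modulo the elements `u ∧ πi`. -/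
lemma exists_logWedge {A : Type*} [AddCommGroup A] {F : L2C →+ A} (hF : ∀ a ∈ wedgePi.range, F a = 0) :
    ∃ G : L2CU →+ A, ∀ a b, G (wedgeExp (wedge a b)) = F (wedgeHom ℂ (a / 2) b) := by
  have hl : ∀ (n : ℤ) b, F (wedgeHom ℂ (n * (Cpi * I)) b) = 0 := fun n b =>
    hF _ (wedgePi_mem_left n b)
  have hr : ∀ (n : ℤ) a, F (wedgeHom ℂ a (2 * (n * (Cpi * I)))) = 0 := fun n a =>
    hF _ (wedgePi_mem_right n a)
  let f : ℂˣ → ℂˣ → A := fun a b => F (wedgeHom ℂ (log a / 2) (log b))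
  have right : ∀ a b b', f a (b * b') = f a b + f a b' := fun a b b' => by
    obtain ⟨n, hn⟩ := exists_log_mul b b'
    simp only [f]
    rw [hn, map_add, map_add, map_add, map_add, hr, add_zero]
  have left : ∀ a a' b, f (a * a') b = f a b + f a' b := fun a a' b => by
    obtain ⟨n, hn⟩ := exists_log_mul a a'
    simp only [f]
    rw [hn, add_div, add_div, mul_div_cancel_left₀ _ two_ne_zero, map_add, map_add,
      AddMonoidHom.add_apply, AddMonoidHom.add_apply, map_add, map_add, hl, add_zero]
  have self : ∀ a, f a a = 0 := fun a => by
    have e : wedgeHom ℂ (log a / 2) (log a) = 0 := by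
      nth_rewrite 2 [← add_halves (log (a : ℂ))]
      rw [map_add, wedgeHom_self, add_zero]
    simp only [f]
    rw [e, map_zero]
  let B : Additive ℂˣ →+ Additive ℂˣ →+ A :=
    AddMonoidHom.mk' (fun a => AddMonoidHom.mk' (fun b => f a.toMul b.toMul) fun b b' =>
      right a.toMul b.toMul b'.toMul) fun a a' => AddMonoidHom.ext fun b =>
        left a.toMul a'.toMul b.toMul
  obtain ⟨G, hG⟩ := exists_hom_exteriorPower B fun a => self a.toMul
  refine ⟨G, fun a b => ?_⟩
  rw [wedgeExp_wedge]
  refine (hG _ _).trans ?_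
  change F (wedgeHom ℂ (log (exp a) / 2) (log (exp b))) = _
  obtain ⟨m, hm⟩ := exists_log_exp a
  obtain ⟨n, hn⟩ := exists_log_exp b
  rw [hm, hn, add_div, mul_div_cancel_left₀ _ two_ne_zero, map_add, map_add, hr, add_zero, map_add,
    AddMonoidHom.add_apply, map_add, hl, add_zero]

lemma exists_wedge_eq_of_two_nsmul_wedgeExp_eq_zero {t : L2C} (ht : (2 : ℕ) • wedgeExp t = 0) :
    ∃ u, wedge u (Cpi * I) = t := by
  obtain ⟨G, hG⟩ := exists_logWedge (F := QuotientAddGroup.mk' wedgePi.range) fun a ha =>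
    (QuotientAddGroup.eq_zero_iff a).2 ha
  have h : (2 : ℕ) • G.comp wedgeExp = QuotientAddGroup.mk' wedgePi.range :=
    exteriorPower_hom_ext fun a b => by
      rw [AddMonoidHom.nsmul_apply, AddMonoidHom.comp_apply, ← wedge_eq_wedgeHom, hG,
        ← map_nsmul, ← AddMonoidHom.nsmul_apply, ← map_nsmul, two_nsmul, add_halves]
      rfl
  have h1 := DFunLike.congr_fun h t
  rw [AddMonoidHom.nsmul_apply, AddMonoidHom.comp_apply, ← map_nsmul, ht, map_zero] at h1
  exact (QuotientAddGroup.eq_zero_iff (N := wedgePi.range) t).1 h1.symm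

lemma nuHom_chiHom_expHom (u : ℂ) : nuHom (chiHom (expHom u)) = wedge u (Cpi * I) := by
  obtain ⟨n, hn⟩ := exists_log_exp u
  have := nuHom_chiFun (exp_ne_zero u)
  rw [hn, wedge_eq_wedgeHom, map_add, AddMonoidHom.add_apply, ← mul_assoc] at this
  refine this.trans ?_
  have e : wedgeHom ℂ (2 * n * (Cpi * I)) (Cpi * I) = 0 := by
    exact_mod_cast wedgeHom_int_mul (2 * n) (Cpi * I)
  rw [e, add_zero, wedge_eq_wedgeHom]

lemma exists_mem_EBloch_pbHom_eq {b : PreBloch} (hb : b ∈ Bloch) : ∃ a ∈ EBloch, pbHom a = b := by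
  obtain ⟨a, rfl⟩ := pbHom_surjective b
  have h : nuPB (pbHom a) = 0 := hb
  rw [nuPB_pbHom, neg_eq_zero] at h
  obtain ⟨u, hu⟩ := exists_wedge_eq_of_two_nsmul_wedgeExp_eq_zero h
  refine ⟨a - chiHom (expHom u), ?_, ?_⟩
  · change nuHom _ = 0
    rw [map_sub, nuHom_chiHom_expHom, hu, sub_self]
  · rw [map_sub, pbHom_eq_zero_iff.2 ⟨_, rfl⟩, sub_zero]

/-- `χ` maps the roots of unity `μ*` into `êB(ℂ)`, and the resulting sequence
`0 → μ* → êB(ℂ) → B(ℂ) → 0` is exact, where `êB(ℂ) → B(ℂ)` is induced by `[z,p,q] ↦ [z]`. -/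
theorem stmt17 :
    ∃ (Ψ : EPreBloch →+ PreBloch) (χ : Additive ℂˣ →+ EPreBloch),
      (∀ (z : ℂ), Reg z → ∀ (p q : ℤ), Ψ (cls z p q) = pbCls z) ∧
      (∀ (z : ℂ) (h0 : z ≠ 0), z ≠ 1 →
        χ (Additive.ofMul (Units.mk0 z h0)) = cls z 0 1 - cls z 0 0) ∧
      (∀ ζ : ℂˣ, ζ ∈ muStar → χ (Additive.ofMul ζ) ∈ EBloch) ∧
      (∀ a ∈ EBloch, Ψ a ∈ Bloch) ∧
      Set.InjOn (fun ζ : ℂˣ => χ (Additive.ofMul ζ)) muStar ∧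
      (∀ a ∈ EBloch, (Ψ a = 0 ↔ ∃ ζ ∈ muStar, χ (Additive.ofMul ζ) = a)) ∧
      (∀ b ∈ Bloch, ∃ a ∈ EBloch, Ψ a = b) := by
  refine ⟨pbHom, chiHom, fun z h p q => pbHom_cls h p q, fun z h0 _ => chiHom_apply z h0,
    fun ζ => chiHom_mem_EBloch_iff.2, fun a ha => ?_,
    (chiHom_injective.comp Additive.ofMul.injective).injOn, fun a ha => ?_,
    fun b => exists_mem_EBloch_pbHom_eq⟩
  · have h : nuHom a = 0 := ha
    change nuPB (pbHom a) = 0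
    rw [nuPB_pbHom, h, map_zero, smul_zero, neg_zero]
  · rw [pbHom_eq_zero_iff]
    constructor
    · rintro ⟨u, rfl⟩
      exact ⟨u.toMul, chiHom_mem_EBloch_iff.1 ha, rfl⟩
    · rintro ⟨ζ, -, h⟩
      exact ⟨_, h⟩

end ExtendedBloch

end
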